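/- Let n ≥ 3, 0 < α ≤ n−2, γ* > 0 and C > 0. For a real-valued even Schwartz function u₀ on ℝⁿ write u(x,t) := e^{it√(−Δ)}u₀(x), with time derivative ∂_t u(x,t) = ∫_{ℝⁿ} 2πi|ξ| e^{2πi(x·ξ + t|ξ|)} û₀(ξ) dξ and spatial gradient ∇u(x,t) = ∫_{ℝⁿ} 2πiξ e^{2πi(x·ξ + t|ξ|)} û₀(ξ) dξ. Suppose that for every such u₀ and every even finite Borel measure μ on ℝⁿ supported in B(0,4) with [μ]_α < ∞ one has ∫₀¹ ∫_{ℝⁿ} (|∂_t u(x,t)|² − |∇u(x,t)|²) ((−Δ)^{−1}μ)(x) dx dt ≤ C [μ]_α ‖u₀‖²_{H^{(n−α)/2 − γ*}}. Then for every γ < min{γ*, 1/2} there is a constant C' > 0 such that for all such u₀ and μ one has ∫₀¹ ∫_{ℝⁿ} |u(x,t)|² dμ(x) dt ≤ C' [μ]_α ‖u₀‖²_{H^{(n−α)/2 − γ}}. -/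

import Mathlib

open MeasureTheory Real Metric
open scoped ENNReal RealInnerProductSpace

noncomputable section

abbrev E (n : ℕ) : Type := EuclideanSpace ℝ (Fin n)

/-- The Frostman constant `[μ]_α = sup_{x,r>0} μ(B(x,r))/r^α`. -/
def frostman {d : ℕ} (μ : Measure (E d)) (α : ℝ) : ℝ≥0∞ :=
  ⨆ (x : E d) (r : ℝ) (_ : 0 < r), μ (Metric.ball x r) / ENNReal.ofReal (r ^ α)

/-- The Fourier transform `f̂(ξ) = ∫ e^{-2πi x·ξ} f(x) dx`. -/
def FT {n : ℕ} (f : E n → ℂ) (ξ : E n) : ℂ :=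
  ∫ x, Complex.exp (((-2 * π * ⟪x, ξ⟫ : ℝ) : ℂ) * Complex.I) * f x

/-- The Sobolev norm `‖f‖_{H^s} = (∫ (1+|ξ|²)^s |f̂(ξ)|² dξ)^{1/2}`. -/
def sobolevNorm {n : ℕ} (f : E n → ℂ) (s : ℝ) : ℝ :=
  (∫ ξ : E n, (1 + ‖ξ‖ ^ 2) ^ s * ‖FT f ξ‖ ^ 2) ^ (1/2 : ℝ)

/-- The half-wave propagator `e^{it√(-Δ)}f(x) = ∫ e^{2πi(x·ξ+t|ξ|)} f̂(ξ) dξ`. -/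
def halfWave {n : ℕ} (f : E n → ℂ) (t : ℝ) (x : E n) : ℂ :=
  ∫ ξ : E n, Complex.exp (((2 * π * (⟪x, ξ⟫ + t * ‖ξ‖) : ℝ) : ℂ) * Complex.I) * FT f ξ

/-- The time derivative `∂_t u(x,t)` of the half-wave evolution
`u(x,t) = e^{it√(-Δ)}f(x)`. -/
def dtWave {n : ℕ} (f : E n → ℂ) (t : ℝ) (x : E n) : ℂ :=
  ∫ ξ : E n, ((2 * π * ‖ξ‖ : ℝ) : ℂ) * Complex.I *
    Complex.exp (((2 * π * (⟪x, ξ⟫ + t * ‖ξ‖) : ℝ) : ℂ) * Complex.I) * FT f ξ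

/-- The `i`-th component of the spatial gradient `∇u(x,t)` of the half-wave evolution. -/
def gradWaveComp {n : ℕ} (f : E n → ℂ) (t : ℝ) (x : E n) (i : Fin n) : ℂ :=
  ∫ ξ : E n, ((2 * π * ξ i : ℝ) : ℂ) * Complex.I *
    Complex.exp (((2 * π * (⟪x, ξ⟫ + t * ‖ξ‖) : ℝ) : ℂ) * Complex.I) * FT f ξ

/-- The Newtonian potential `(-Δ)⁻¹μ(x)` of a measure `μ` on `ℝⁿ`, `n ≥ 3`. -/
def newtonianPotential {n : ℕ} (μ : Measure (E n)) (x : E n) : ℝ :=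
  (Real.Gamma ((n : ℝ) / 2 - 1) / (4 * π ^ ((n : ℝ) / 2))) *
    ∫ y, ‖x - y‖ ^ (2 - (n : ℝ)) ∂μ

/-- The trigonometric integral `x ↦ ∫ e^{2πi x·ξ} A(ξ) dξ` of a real-valued amplitude. -/
def synth {n : ℕ} (A : E n → ℝ) (x : E n) : ℂ :=
  ∫ ξ : E n, Complex.exp (((2 * π * ⟪x, ξ⟫ : ℝ) : ℂ) * Complex.I) * (A ξ : ℂ)

/-- The heat kernel `(4πτ)^{-n/2} e^{-|z|²/(4τ)}`. -/
def heat {n : ℕ} (τ : ℝ) (z : E n) : ℝ :=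
  (4 * π * τ) ^ (-((n : ℝ) / 2)) * exp (-(‖z‖ ^ 2 / (4 * τ)))

section Synth

variable {n : ℕ}

lemma integrable_exp_mul_ofReal {A : E n → ℝ} (hA : Integrable A) (x : E n) :
    Integrable fun ξ : E n =>
      Complex.exp (((2 * π * ⟪x, ξ⟫ : ℝ) : ℂ) * Complex.I) * (A ξ : ℂ) := by
  refine hA.ofReal.bdd_mul (c := 1) (by fun_prop) (ae_of_all _ fun ξ => ?_)
  rw [Complex.norm_exp_ofReal_mul_I]

lemma norm_synth_le {A : E n → ℝ} (x : E n) : ‖synth A x‖ ≤ ∫ ξ, |A ξ| := by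
  refine (norm_integral_le_integral_norm _).trans_eq ?_
  simp only [norm_mul, Complex.norm_exp_ofReal_mul_I, one_mul, Complex.norm_real, norm_eq_abs]

lemma continuous_synth {A : E n → ℝ} (hA : Integrable A) : Continuous (synth A) := by
  refine continuous_of_dominated (bound := fun ξ => |A ξ|) ?_ ?_ hA.abs ?_
  · exact fun x => (integrable_exp_mul_ofReal hA x).aestronglyMeasurable
  · refine fun x => ae_of_all _ fun ξ => ?_
    simp only [norm_mul, Complex.norm_exp_ofReal_mul_I, one_mul, Complex.norm_real, norm_eq_abs,
      le_refl]
  · exact ae_of_all _ fun ξ => by fun_prop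

lemma normSq_synth {A : E n → ℝ} (hA : Integrable A) (x : E n) :
    ‖synth A x‖ ^ 2 =
      ∫ p : E n × E n, A p.1 * A p.2 * cos (2 * π * ⟪x, p.1 - p.2⟫) := by
  have hi := integrable_exp_mul_ofReal hA x
  have hc : Integrable fun ξ : E n => (starRingEnd ℂ)
      (Complex.exp (((2 * π * ⟪x, ξ⟫ : ℝ) : ℂ) * Complex.I) * (A ξ : ℂ)) :=
    (Complex.conjLIE.toContinuousLinearEquiv.toContinuousLinearMap.integrable_comp hi)
  have h1 : ((‖synth A x‖ ^ 2 : ℝ) : ℂ) = ∫ p : E n × E n,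
      (Complex.exp (((2 * π * ⟪x, p.1⟫ : ℝ) : ℂ) * Complex.I) * (A p.1 : ℂ)) *
        (starRingEnd ℂ)
          (Complex.exp (((2 * π * ⟪x, p.2⟫ : ℝ) : ℂ) * Complex.I) * (A p.2 : ℂ)) := by
    rw [Measure.volume_eq_prod, integral_prod_mul
      (fun ξ : E n => Complex.exp (((2 * π * ⟪x, ξ⟫ : ℝ) : ℂ) * Complex.I) * (A ξ : ℂ))
      (fun ξ : E n => (starRingEnd ℂ)
        (Complex.exp (((2 * π * ⟪x, ξ⟫ : ℝ) : ℂ) * Complex.I) * (A ξ : ℂ))), integral_conj]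
    change _ = synth A x * (starRingEnd ℂ) (synth A x)
    rw [Complex.mul_conj, Complex.normSq_eq_norm_sq]
  have h2 := congrArg Complex.re h1
  rw [Complex.ofReal_re] at h2
  rw [h2]
  have hp := hi.mul_prod hc
  rw [← Measure.volume_eq_prod] at hp
  refine (integral_re (𝕜 := ℂ) hp).symm.trans ?_
  congr 1 with p
  change Complex.re _ = _
  have : (Complex.exp (((2 * π * ⟪x, p.1⟫ : ℝ) : ℂ) * Complex.I) * (A p.1 : ℂ)) *
        (starRingEnd ℂ)
          (Complex.exp (((2 * π * ⟪x, p.2⟫ : ℝ) : ℂ) * Complex.I) * (A p.2 : ℂ)) =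
      ((A p.1 * A p.2 : ℝ) : ℂ) *
        Complex.exp (((2 * π * ⟪x, p.1 - p.2⟫ : ℝ) : ℂ) * Complex.I) := by
    rw [map_mul, ← Complex.exp_conj, map_mul, Complex.conj_I, Complex.conj_ofReal,
      Complex.conj_ofReal, inner_sub_right]
    have : (((2 * π * (⟪x, p.1⟫ - ⟪x, p.2⟫) : ℝ) : ℂ) * Complex.I) =
      (((2 * π * ⟪x, p.1⟫ : ℝ) : ℂ) * Complex.I) +
        (((2 * π * ⟪x, p.2⟫ : ℝ) : ℂ) * -Complex.I) := by
      push_cast; ring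
    rw [this, Complex.exp_add]
    push_cast
    ring
  rw [this, Complex.re_ofReal_mul, Complex.exp_ofReal_mul_I_re]

lemma integral_cos_mul_gaussian {b : ℝ} (hb : 0 < b) (y w : E n) :
    ∫ x : E n, cos (2 * π * ⟪x, w⟫) * exp (-b * ‖x - y‖ ^ 2) =
      (π / b) ^ ((n : ℝ) / 2) * (cos (2 * π * ⟪y, w⟫) * exp (-(π ^ 2 * ‖w‖ ^ 2 / b))) := by
  have hb' : 0 < (b : ℂ).re := by simpa using hb
  have h0 := GaussianFourier.integral_cexp_neg_mul_sq_norm_add hb' (2 * π * Complex.I) w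
  have hi := GaussianFourier.integrable_cexp_neg_mul_sq_norm_add hb' (2 * π * Complex.I) w
  rw [← integral_add_right_eq_self _ y]
  have h3 : ∫ v : E n, Complex.exp (((2 * π * ⟪y, w⟫ : ℝ) : ℂ) * Complex.I) *
      Complex.exp (-(b : ℂ) * ‖v‖ ^ 2 + 2 * π * Complex.I * ⟪w, v⟫) =
      ((π / b : ℝ) : ℂ) ^ (((n : ℝ) / 2 : ℝ) : ℂ) * (((exp (-(π ^ 2 * ‖w‖ ^ 2 / b)) : ℝ) : ℂ) *
        Complex.exp (((2 * π * ⟪y, w⟫ : ℝ) : ℂ) * Complex.I)) := by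
    rw [integral_const_mul, h0]
    have : (2 * π * Complex.I) ^ 2 * (‖w‖ : ℂ) ^ 2 / (4 * b) =
      ((-(π ^ 2 * ‖w‖ ^ 2 / b) : ℝ) : ℂ) := by
      push_cast
      rw [mul_pow, Complex.I_sq]
      have : (b : ℂ) ≠ 0 := by exact_mod_cast hb.ne'
      field_simp
      ring
    rw [this]
    simp only [finrank_euclideanSpace, Fintype.card_fin]
    push_cast
    ring
  have h4 := congrArg Complex.re h3
  rw [← Complex.ofReal_cpow (by positivity), Complex.re_ofReal_mul, Complex.re_ofReal_mul,
    Complex.exp_ofReal_mul_I_re] at h4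
  have h5 : (∫ v : E n, Complex.exp (((2 * π * ⟪y, w⟫ : ℝ) : ℂ) * Complex.I) *
      Complex.exp (-(b : ℂ) * ‖v‖ ^ 2 + 2 * π * Complex.I * ⟪w, v⟫)).re =
      ∫ v : E n, cos (2 * π * ⟪v + y, w⟫) * exp (-b * ‖v + y - y‖ ^ 2) := by
    refine (integral_re (𝕜 := ℂ) (hi.const_mul _)).symm.trans ?_
    congr 1 with v
    change Complex.re _ = _
    have : Complex.exp (((2 * π * ⟪y, w⟫ : ℝ) : ℂ) * Complex.I) *
      Complex.exp (-(b : ℂ) * ‖v‖ ^ 2 + 2 * π * Complex.I * ⟪w, v⟫) =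
      ((exp (-b * ‖v‖ ^ 2) : ℝ) : ℂ) *
        Complex.exp (((2 * π * ⟪v + y, w⟫ : ℝ) : ℂ) * Complex.I) := by
      rw [Complex.ofReal_exp, ← Complex.exp_add, ← Complex.exp_add, inner_add_left,
        real_inner_comm w v]
      congr 1
      push_cast
      ring
    rw [this, Complex.re_ofReal_mul, Complex.exp_ofReal_mul_I_re, add_sub_cancel_right, mul_comm]
  rw [← h5, h4]
  ring

lemma integrable_gaussian {b : ℝ} (hb : 0 < b) (y : E n) :
    Integrable fun x : E n => exp (-b * ‖x - y‖ ^ 2) := by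
  have hb' : 0 < (b : ℂ).re := by simpa using hb
  have hi := (GaussianFourier.integrable_cexp_neg_mul_sq_norm_add hb' 0 (0 : E n)).re
  have h0 : Integrable fun x : E n => exp (-b * ‖x‖ ^ 2) := by
    refine hi.congr (ae_of_all _ fun v => ?_)
    change Complex.re _ = _
    rw [zero_mul, add_zero]
    have := Complex.exp_ofReal_re (-b * ‖v‖ ^ 2)
    push_cast at this
    exact this
  exact h0.comp_sub_right y

lemma integral_normSq_synth_mul_gaussian {A : E n → ℝ} (hA : Integrable A) {b : ℝ} (hb : 0 < b)
    (y : E n) :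
    ∫ x : E n, ‖synth A x‖ ^ 2 * exp (-b * ‖x - y‖ ^ 2) =
      (π / b) ^ ((n : ℝ) / 2) * ∫ p : E n × E n, A p.1 * A p.2 *
        (cos (2 * π * ⟪y, p.1 - p.2⟫) * exp (-(π ^ 2 * ‖p.1 - p.2‖ ^ 2 / b))) := by
  simp_rw [normSq_synth hA, ← integral_mul_const]
  rw [integral_integral_swap]
  · rw [← integral_const_mul]
    congr 1 with p
    have := integral_cos_mul_gaussian hb y (p.1 - p.2)
    simp_rw [mul_assoc (A p.1 * A p.2)]
    rw [integral_const_mul, this]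
    ring
  · have h := (integrable_gaussian hb y).mul_prod (hA.mul_prod hA)
    rw [← Measure.volume_eq_prod] at h
    have h2 := h.bdd_mul (c := 1) (f := fun z : E n × (E n × E n) =>
      cos (2 * π * ⟪z.1, z.2.1 - z.2.2⟫)) (by fun_prop)
      (ae_of_all _ fun z => by simpa using abs_cos_le_one _)
    refine h2.congr (ae_of_all _ fun z => ?_)
    simp only [Function.uncurry]
    ring

lemma heat_eq {τ : ℝ} (z : E n) :
    heat τ z = (4 * π * τ) ^ (-((n : ℝ) / 2)) * exp (-(1 / (4 * τ)) * ‖z‖ ^ 2) := by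
  rw [heat]
  congr 2
  ring

lemma heat_nonneg {τ : ℝ} (hτ : 0 < τ) (z : E n) : 0 ≤ heat τ z := by
  unfold heat; positivity

lemma integrable_heat {τ : ℝ} (hτ : 0 < τ) (y : E n) :
    Integrable fun x : E n => heat τ (x - y) := by
  simp_rw [heat_eq]
  exact (integrable_gaussian (by positivity) y).const_mul _

lemma integral_normSq_synth_mul_heat {A : E n → ℝ} (hA : Integrable A) {τ : ℝ} (hτ : 0 < τ)
    (y : E n) :
    ∫ x : E n, ‖synth A x‖ ^ 2 * heat τ (x - y) =
      ∫ p : E n × E n, A p.1 * A p.2 *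
        (cos (2 * π * ⟪y, p.1 - p.2⟫) * exp (-(4 * π ^ 2 * ‖p.1 - p.2‖ ^ 2 * τ))) := by
  have h := integral_normSq_synth_mul_gaussian hA (b := 1 / (4 * τ)) (by positivity) y
  simp_rw [heat_eq, mul_left_comm (‖synth A _‖ ^ 2), integral_const_mul]
  rw [h]
  rw [← mul_assoc, show π / (1 / (4 * τ)) = 4 * π * τ by field_simp,
    ← rpow_add (by positivity), neg_add_cancel, rpow_zero, one_mul]
  congr 1 with p
  congr 4
  field_simp

lemma integral_heat {τ : ℝ} (hτ : 0 < τ) (y : E n) : ∫ x : E n, heat τ (x - y) = 1 := by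
  have h := integral_cos_mul_gaussian (b := 1 / (4 * τ)) (by positivity) y (0 : E n)
  simp only [inner_zero_right, mul_zero, cos_zero, one_mul, norm_zero, ne_eq, OfNat.ofNat_ne_zero,
    not_false_eq_true, zero_pow, zero_div, neg_zero, exp_zero, mul_one] at h
  simp_rw [heat_eq, integral_const_mul]
  rw [h]
  rw [show π / (1 / (4 * τ)) = 4 * π * τ by field_simp,
    ← rpow_add (by positivity), neg_add_cancel, rpow_zero]

end Synth

/-- The fundamental solution of `-Δ` on `ℝⁿ`. -/
def newtonKernel {n : ℕ} (z : E n) : ℝ :=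
  Real.Gamma ((n : ℝ) / 2 - 1) / (4 * π ^ ((n : ℝ) / 2)) * ‖z‖ ^ (2 - (n : ℝ))

section Newton

variable {n : ℕ}

lemma half_dim_sub_one_pos (hn : 3 ≤ n) : 0 < (n : ℝ) / 2 - 1 := by
  have : (3 : ℝ) ≤ n := by exact_mod_cast hn
  linarith

lemma newtonKernel_nonneg (hn : 3 ≤ n) (z : E n) : 0 ≤ newtonKernel z := by
  have := Real.Gamma_pos_of_pos (half_dim_sub_one_pos hn)
  unfold newtonKernel
  positivity

lemma measurable_newtonKernel : Measurable (newtonKernel : E n → ℝ) := by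
  unfold newtonKernel
  fun_prop

lemma measurable_heat : Measurable fun q : ℝ × E n => heat q.1 q.2 := by
  unfold heat
  fun_prop

lemma integral_heat_time (hn : 3 ≤ n) {z : E n} (hz : z ≠ 0) :
    ∫ τ in Set.Ioi (0 : ℝ), heat τ z = newtonKernel z := by
  have hz' : 0 < ‖z‖ := norm_pos_iff.mpr hz
  rw [← integral_comp_rpow_Ioi (fun τ => heat τ z) (p := -1) (by norm_num)]
  have h1 : ∀ v ∈ Set.Ioi (0 : ℝ), (|(-1 : ℝ)| * v ^ ((-1 : ℝ) - 1)) • heat (v ^ (-1 : ℝ)) z =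
      (4 * π) ^ (-((n : ℝ) / 2)) *
        (v ^ (((n : ℝ) / 2 - 1) - 1) * exp (-(‖z‖ ^ 2 / 4 * v))) := by
    intro v hv
    have hv : 0 < v := hv
    rw [heat, smul_eq_mul, rpow_neg_one, mul_rpow (by positivity) (by positivity),
      inv_rpow hv.le, ← rpow_neg hv.le, neg_neg,
      show (n : ℝ) / 2 - 1 - 1 = (-1 - 1) + (n : ℝ) / 2 by ring, rpow_add hv]
    have : ‖z‖ ^ 2 / (4 * v⁻¹) = ‖z‖ ^ 2 / 4 * v := by field_simp
    rw [this]
    norm_num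
    ring
  rw [setIntegral_congr_fun measurableSet_Ioi h1, integral_const_mul,
    integral_rpow_mul_exp_neg_mul_Ioi (half_dim_sub_one_pos hn) (by positivity), newtonKernel]
  have h2 : (1 / (‖z‖ ^ 2 / 4)) ^ ((n : ℝ) / 2 - 1) =
      4 ^ ((n : ℝ) / 2 - 1) * ‖z‖ ^ (2 - (n : ℝ)) := by
    rw [one_div_div, div_rpow (by positivity) (by positivity), div_eq_mul_inv,
      ← rpow_natCast, ← rpow_mul hz'.le, ← rpow_neg hz'.le]
    congr 2
    push_cast
    ring
  rw [h2, mul_rpow (by positivity) (by positivity), rpow_sub (by norm_num) _ (1 : ℝ), rpow_neg (by positivity),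
    rpow_neg (by positivity), rpow_one]
  have : (4 : ℝ) ^ ((n : ℝ) / 2) ≠ 0 := by positivity
  field_simp

lemma heat_le {τ : ℝ} (hτ : 0 < τ) (z : E n) : heat τ z ≤ τ ^ (-((n : ℝ) / 2)) := by
  rw [heat, ← mul_one (τ ^ _)]
  refine mul_le_mul ?_ (exp_le_one_iff.mpr ?_) (exp_nonneg _) (by positivity)
  · refine rpow_le_rpow_of_nonpos hτ ?_ (neg_nonpos.mpr (by positivity))
    nlinarith [pi_gt_three]
  · exact neg_nonpos.mpr (by positivity)

/-- A majorant, integrable in time, of `∫ |φ| h_τ(· - y)` for bounded integrable `φ`. -/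
def heatMajorant (n : ℕ) (M K τ : ℝ) : ℝ :=
  (Set.Ioc (0 : ℝ) 1).indicator (fun _ => M) τ +
    (Set.Ioi (1 : ℝ)).indicator (fun τ => K * τ ^ (-((n : ℝ) / 2))) τ

lemma integrable_heatMajorant (hn : 3 ≤ n) (M K : ℝ) : Integrable (heatMajorant n M K) := by
  refine Integrable.add ?_ ?_
  · exact (integrable_indicator_iff measurableSet_Ioc).mpr (by simp)
  · refine (integrable_indicator_iff measurableSet_Ioi).mpr (Integrable.const_mul ?_ _)
    exact integrableOn_Ioi_rpow_of_lt (by linarith [half_dim_sub_one_pos hn]) one_pos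

lemma integrable_mul_heat {φ : E n → ℝ} (hφ : Integrable φ) {τ : ℝ} (hτ : 0 < τ) (y : E n) :
    Integrable fun x => φ x * heat τ (x - y) := by
  refine Integrable.mul_bdd (c := τ ^ (-((n : ℝ) / 2))) hφ ?_ (ae_of_all _ fun x => ?_)
  · exact (integrable_heat hτ y).aestronglyMeasurable
  · rw [norm_of_nonneg (heat_nonneg hτ _)]
    exact heat_le hτ _

lemma integral_abs_mul_heat_le {φ : E n → ℝ} (hφ : Integrable φ) {M : ℝ} (hM : ∀ x, |φ x| ≤ M)
    {τ : ℝ} (hτ : 0 < τ) (y : E n) :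
    ∫ x, |φ x| * heat τ (x - y) ≤ heatMajorant n M (∫ x, |φ x|) τ := by
  rcases le_or_gt τ 1 with h | h
  · rw [heatMajorant, Set.indicator_of_mem (Set.mem_Ioc.mpr ⟨hτ, h⟩),
      Set.indicator_of_notMem (by simpa using h), add_zero]
    calc ∫ x, |φ x| * heat τ (x - y) ≤ ∫ x, M * heat τ (x - y) := by
          refine integral_mono (integrable_mul_heat hφ.abs hτ y)
            ((integrable_heat hτ y).const_mul _) fun x => ?_
          exact mul_le_mul_of_nonneg_right (hM x) (heat_nonneg hτ _)
      _ = M := by rw [integral_const_mul, integral_heat hτ, mul_one]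
  · rw [heatMajorant, Set.indicator_of_notMem (by simpa using fun _ => h),
      Set.indicator_of_mem (Set.mem_Ioi.mpr h), zero_add, ← integral_mul_const]
    refine integral_mono (integrable_mul_heat hφ.abs hτ y) (hφ.abs.mul_const _) fun x => ?_
    exact mul_le_mul_of_nonneg_left (heat_le hτ _) (abs_nonneg _)

lemma integrable_mul_heat_prod (hn : 3 ≤ n) {φ : E n → ℝ} (hφ : Integrable φ) {M : ℝ}
    (hM : ∀ x, |φ x| ≤ M) (y : E n) :
    Integrable (fun q : E n × ℝ => φ q.1 * heat q.2 (q.1 - y))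
      (volume.prod (volume.restrict (Set.Ioi (0 : ℝ)))) := by
  have hm : AEStronglyMeasurable (fun q : E n × ℝ => φ q.1 * heat q.2 (q.1 - y))
      (volume.prod (volume.restrict (Set.Ioi (0 : ℝ)))) := by
    refine hφ.aestronglyMeasurable.comp_fst.mul ?_
    exact (measurable_heat.comp (measurable_snd.prodMk
      (measurable_fst.sub_const y))).aestronglyMeasurable
  refine (integrable_prod_iff' hm).mpr ⟨?_, ?_⟩
  · exact (ae_restrict_iff' measurableSet_Ioi).mpr
      (ae_of_all _ fun τ hτ => integrable_mul_heat hφ hτ y)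
  · refine (integrable_heatMajorant hn M (∫ x, |φ x|)).restrict.mono'
      hm.norm.prod_swap.integral_prod_right' ?_
    refine (ae_restrict_iff' measurableSet_Ioi).mpr (ae_of_all _ fun τ hτ => ?_)
    rw [norm_of_nonneg (integral_nonneg fun _ => norm_nonneg _)]
    refine le_trans (le_of_eq ?_) (integral_abs_mul_heat_le hφ hM hτ y)
    congr 1 with x
    rw [norm_mul, norm_of_nonneg (heat_nonneg hτ _), norm_eq_abs]

lemma ae_ne_point (hn : 3 ≤ n) (y : E n) : ∀ᵐ x : E n, x ≠ y := by
  have : Nonempty (Fin n) := ⟨⟨0, by omega⟩⟩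
  exact (measure_eq_zero_iff_ae_notMem.mp (measure_singleton y))

lemma integral_mul_newtonKernel (hn : 3 ≤ n) {φ : E n → ℝ} (hφ : Integrable φ) {M : ℝ}
    (hM : ∀ x, |φ x| ≤ M) (y : E n) :
    ∫ x, φ x * newtonKernel (x - y) =
      ∫ τ in Set.Ioi (0 : ℝ), ∫ x, φ x * heat τ (x - y) := by
  rw [← integral_integral_swap (integrable_mul_heat_prod hn hφ hM y)]
  refine integral_congr_ae ?_
  filter_upwards [ae_ne_point hn y] with x hx
  rw [integral_const_mul, integral_heat_time hn (sub_ne_zero.mpr hx)]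

lemma integrable_mul_newtonKernel (hn : 3 ≤ n) {φ : E n → ℝ} (hφ : Integrable φ) {M : ℝ}
    (hM : ∀ x, |φ x| ≤ M) (y : E n) :
    Integrable fun x => φ x * newtonKernel (x - y) := by
  refine (integrable_mul_heat_prod hn hφ hM y).integral_prod_left.congr ?_
  filter_upwards [ae_ne_point hn y] with x hx
  rw [integral_const_mul, integral_heat_time hn (sub_ne_zero.mpr hx)]

lemma integral_abs_mul_newtonKernel_le (hn : 3 ≤ n) {φ : E n → ℝ} (hφ : Integrable φ) {M : ℝ}
    (hM : ∀ x, |φ x| ≤ M) (y : E n) :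
    ∫ x, |φ x| * newtonKernel (x - y) ≤
      ∫ τ in Set.Ioi (0 : ℝ), heatMajorant n M (∫ x, |φ x|) τ := by
  have hM' : ∀ x, |(|φ x|)| ≤ M := fun x => by rw [abs_abs]; exact hM x
  rw [integral_mul_newtonKernel hn hφ.abs hM' y]
  refine setIntegral_mono_on ?_ (integrable_heatMajorant hn _ _).integrableOn
    measurableSet_Ioi fun τ hτ => integral_abs_mul_heat_le hφ hM hτ y
  exact (integrable_mul_heat_prod hn hφ.abs hM' y).integral_prod_right

lemma integrable_mul_newtonKernel_prod (hn : 3 ≤ n) {φ : E n → ℝ} (hφ : Integrable φ) {M : ℝ}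
    (hM : ∀ x, |φ x| ≤ M) (μ : Measure (E n)) [IsFiniteMeasure μ] :
    Integrable (fun q : E n × E n => φ q.1 * newtonKernel (q.1 - q.2)) (volume.prod μ) := by
  have hm : AEStronglyMeasurable (fun q : E n × E n => φ q.1 * newtonKernel (q.1 - q.2))
      (volume.prod μ) := by
    refine hφ.aestronglyMeasurable.comp_fst.mul ?_
    exact (measurable_newtonKernel.comp (measurable_fst.sub measurable_snd)).aestronglyMeasurable
  refine (integrable_prod_iff' hm).mpr ⟨ae_of_all _ (integrable_mul_newtonKernel hn hφ hM), ?_⟩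
  refine (integrable_const
      (∫ τ in Set.Ioi (0 : ℝ), heatMajorant n M (∫ x, |φ x|) τ)).mono'
    hm.norm.prod_swap.integral_prod_right' (ae_of_all _ fun y => ?_)
  rw [norm_of_nonneg (integral_nonneg fun _ => norm_nonneg _)]
  refine le_trans (le_of_eq ?_) (integral_abs_mul_newtonKernel_le hn hφ hM y)
  congr 1 with x
  rw [norm_mul, norm_of_nonneg (newtonKernel_nonneg hn _), norm_eq_abs]

lemma newtonianPotential_eq (μ : Measure (E n)) (x : E n) :
    newtonianPotential μ x = ∫ y, newtonKernel (x - y) ∂μ := by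
  simp_rw [newtonianPotential, newtonKernel, integral_const_mul]

lemma integral_mul_newtonianPotential (hn : 3 ≤ n) {φ : E n → ℝ} (hφ : Integrable φ) {M : ℝ}
    (hM : ∀ x, |φ x| ≤ M) (μ : Measure (E n)) [IsFiniteMeasure μ] :
    ∫ x, φ x * newtonianPotential μ x = ∫ y, (∫ x, φ x * newtonKernel (x - y)) ∂μ := by
  rw [← integral_integral_swap (integrable_mul_newtonKernel_prod hn hφ hM μ)]
  simp_rw [newtonianPotential_eq, integral_const_mul]

lemma integrable_mul_newtonianPotential (hn : 3 ≤ n) {φ : E n → ℝ} (hφ : Integrable φ) {M : ℝ}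
    (hM : ∀ x, |φ x| ≤ M) (μ : Measure (E n)) [IsFiniteMeasure μ] :
    Integrable fun x => φ x * newtonianPotential μ x := by
  refine (integrable_mul_newtonKernel_prod hn hφ hM μ).integral_prod_left.congr
    (ae_of_all _ fun x => ?_)
  simp_rw [newtonianPotential_eq, integral_const_mul]

lemma newtonianPotential_nonneg (hn : 3 ≤ n) (μ : Measure (E n)) (x : E n) :
    0 ≤ newtonianPotential μ x := by
  rw [newtonianPotential_eq]
  exact integral_nonneg fun y => newtonKernel_nonneg hn _

/-- The pairing of `∑ c_k |A_k^∨|²` with the Newtonian kernel is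
given by the symbol `∑ c_k A_k(ξ) A_k(η) / (4π²|ξ - η|²)`. -/
lemma integral_sum_normSq_synth_mul_newtonKernel (hn : 3 ≤ n) {ι : Type*} [Fintype ι]
    {A : ι → E n → ℝ} (hA : ∀ k, Integrable (A k))
    (hA2 : ∀ k, Integrable fun x => ‖synth (A k) x‖ ^ 2) (c : ι → ℝ)
    {S₀ : E n × E n → ℝ} (hS₀ : Integrable S₀) (hS₀_nonneg : ∀ p, 0 ≤ S₀ p)
    (hS : ∀ p : E n × E n, |∑ k, c k * (A k p.1 * A k p.2)| ≤ ‖p.1 - p.2‖ ^ 2 * S₀ p) (y : E n) :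
    ∫ x, (∑ k, c k * ‖synth (A k) x‖ ^ 2) * newtonKernel (x - y) =
      ∫ p : E n × E n, (∑ k, c k * (A k p.1 * A k p.2)) / (4 * π ^ 2 * ‖p.1 - p.2‖ ^ 2) *
        cos (2 * π * ⟪y, p.1 - p.2⟫) := by
  set S : E n × E n → ℝ := fun p => ∑ k, c k * (A k p.1 * A k p.2) with hSdef
  have hSint : Integrable S :=
    integrable_finsetSum _ fun k _ => ((hA k).mul_prod (hA k)).const_mul _
  have hbd : ∀ x, |∑ k, c k * ‖synth (A k) x‖ ^ 2| ≤
      ∑ k, |c k| * (∫ ξ, |A k ξ|) ^ 2 := by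
    intro x
    refine (Finset.abs_sum_le_sum_abs _ _).trans (Finset.sum_le_sum fun k _ => ?_)
    rw [abs_mul, abs_of_nonneg (sq_nonneg ‖_‖)]
    gcongr
    exact norm_synth_le x
  have hD : Integrable fun x => ∑ k, c k * ‖synth (A k) x‖ ^ 2 :=
    integrable_finsetSum _ fun k _ => (hA2 k).const_mul _
  rw [integral_mul_newtonKernel hn hD hbd y]
  have hheat : ∀ τ ∈ Set.Ioi (0 : ℝ), ∫ x, (∑ k, c k * ‖synth (A k) x‖ ^ 2) * heat τ (x - y) =
      ∫ p : E n × E n, S p * cos (2 * π * ⟪y, p.1 - p.2⟫) *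
        exp (-(4 * π ^ 2 * ‖p.1 - p.2‖ ^ 2 * τ)) := by
    intro τ hτ
    have hτ : 0 < τ := hτ
    simp_rw [Finset.sum_mul]
    rw [integral_finsetSum]
    · simp_rw [mul_assoc (c _), integral_const_mul, integral_normSq_synth_mul_heat (hA _) hτ y]
      simp_rw [← integral_const_mul]
      rw [← integral_finsetSum]
      · congr 1 with p
        rw [hSdef, Finset.sum_mul, Finset.sum_mul]
        exact Finset.sum_congr rfl fun k _ => by ring
      · intro k _
        refine Integrable.const_mul (Integrable.mul_bdd (c := 1) ((hA k).mul_prod (hA k))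
          (by fun_prop) (ae_of_all _ fun p => ?_)) _
        rw [norm_mul, norm_of_nonneg (exp_nonneg _)]
        exact mul_le_one₀ (abs_cos_le_one _) (exp_nonneg _)
          (exp_le_one_iff.mpr (neg_nonpos.mpr (by positivity)))
    · intro k _
      simp_rw [mul_assoc (c k)]
      exact (integrable_mul_heat (hA2 k) hτ y).const_mul _
  rw [setIntegral_congr_fun measurableSet_Ioi hheat]
  have hzero : ∀ p : E n × E n, ‖p.1 - p.2‖ = 0 → S p = 0 := by
    intro p hp
    have := hS p
    rw [hp] at this
    simpa using this
  have hexp : ∀ {a : ℝ}, 0 < a → IntegrableOn (fun τ : ℝ => exp (-(a * τ))) (Set.Ioi 0) ∧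
      ∫ τ in Set.Ioi (0 : ℝ), exp (-(a * τ)) = 1 / a := by
    intro a ha
    constructor
    · simpa only [neg_mul] using exp_neg_integrableOn_Ioi 0 ha
    · have := integral_exp_mul_Ioi (a := -a) (by linarith) 0
      simp only [neg_mul, mul_zero, exp_zero] at this
      rw [this]
      field_simp
  have htime : ∀ p : E n × E n, ∀ r : ℝ, |r| ≤ |S p| →
      IntegrableOn (fun τ => r * exp (-(4 * π ^ 2 * ‖p.1 - p.2‖ ^ 2 * τ))) (Set.Ioi 0) ∧
      ∫ τ in Set.Ioi (0 : ℝ), r * exp (-(4 * π ^ 2 * ‖p.1 - p.2‖ ^ 2 * τ)) =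
        r / (4 * π ^ 2 * ‖p.1 - p.2‖ ^ 2) := by
    intro p r hr
    rcases eq_or_ne ‖p.1 - p.2‖ 0 with h0 | h0
    · have : r = 0 := by
        rw [hzero p h0, abs_zero] at hr
        exact abs_nonpos_iff.mp hr
      simp [this]
    · have ha : 0 < 4 * π ^ 2 * ‖p.1 - p.2‖ ^ 2 := by positivity
      refine ⟨(hexp ha).1.const_mul r, ?_⟩
      rw [integral_const_mul, (hexp ha).2, mul_one_div]
  have hcos : ∀ p : E n × E n, |S p * cos (2 * π * ⟪y, p.1 - p.2⟫)| ≤ |S p| := by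
    intro p
    rw [abs_mul]
    exact mul_le_of_le_one_right (abs_nonneg _) (abs_cos_le_one _)
  rw [integral_integral_swap]
  · congr 1 with p
    rw [(htime p _ (hcos p)).2]
    ring
  · have hm : AEStronglyMeasurable (Function.uncurry fun (τ : ℝ) (p : E n × E n) =>
        S p * cos (2 * π * ⟪y, p.1 - p.2⟫) * exp (-(4 * π ^ 2 * ‖p.1 - p.2‖ ^ 2 * τ)))
        ((volume.restrict (Set.Ioi (0 : ℝ))).prod volume) := by
      refine ((hSint.aestronglyMeasurable.comp_snd).mul ?_).mul ?_
      · exact Continuous.aestronglyMeasurable (by fun_prop)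
      · exact Continuous.aestronglyMeasurable (by fun_prop)
    refine (integrable_prod_iff' hm).mpr ⟨ae_of_all _ fun p => (htime p _ (hcos p)).1, ?_⟩
    refine (hS₀.const_mul (1 / (4 * π ^ 2))).mono' hm.norm.prod_swap.integral_prod_right'
      (ae_of_all _ fun p => ?_)
    rw [norm_of_nonneg (integral_nonneg fun _ => norm_nonneg _)]
    have h1 : ∫ τ in Set.Ioi (0 : ℝ), ‖Function.uncurry (fun (τ : ℝ) (p : E n × E n) =>
        S p * cos (2 * π * ⟪y, p.1 - p.2⟫) * exp (-(4 * π ^ 2 * ‖p.1 - p.2‖ ^ 2 * τ))) (τ, p)‖ =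
        |S p * cos (2 * π * ⟪y, p.1 - p.2⟫)| / (4 * π ^ 2 * ‖p.1 - p.2‖ ^ 2) := by
      rw [← (htime p _ ((abs_abs _).trans_le (hcos p))).2]
      congr 1 with τ
      simp only [Function.uncurry, norm_mul, norm_eq_abs, abs_exp, abs_mul]
    rw [h1]
    refine (div_le_div_of_nonneg_right ((hcos p).trans (hS p)) (by positivity)).trans ?_
    rcases eq_or_ne ‖p.1 - p.2‖ 0 with h0 | h0
    · rw [h0, zero_pow two_ne_zero, mul_zero, div_zero]
      have := hS₀_nonneg p
      positivity
    · rw [one_div_mul_eq_div]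
      refine le_of_eq ?_
      field_simp

end Newton

section Trace

variable {n : ℕ}

lemma integral_add_rpow_neg {q s : ℝ} (hq : 1 < q) (hs : 0 < s) :
    ∫ τ in Set.Ioi (0 : ℝ), (s + τ) ^ (-q) = s ^ (1 - q) / (q - 1) := by
  have hd : ∀ x ∈ Set.Ici (0 : ℝ),
      HasDerivAt (fun t : ℝ => (s + t) ^ (1 - q) / (1 - q)) ((s + x) ^ (-q)) x := by
    intro x hx
    have hx : 0 ≤ x := hx
    have h := ((hasDerivAt_id x).const_add s).rpow_const (p := 1 - q)
      (Or.inl (ne_of_gt (show 0 < s + x by linarith)))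
    refine (h.div_const (1 - q)).congr_deriv ?_
    rw [show 1 - q - 1 = -q by ring]
    have : 1 - q ≠ 0 := by linarith
    simp only [id]
    field_simp
  have hint : IntegrableOn (fun τ : ℝ => (s + τ) ^ (-q)) (Set.Ioi 0) := by
    simp_rw [add_comm s]
    exact integrableOn_add_rpow_Ioi_of_lt (by linarith) (by linarith)
  have ht : Filter.Tendsto (fun t : ℝ => (s + t) ^ (1 - q) / (1 - q)) Filter.atTop
      (nhds (0 / (1 - q))) := by
    refine Filter.Tendsto.div_const ?_ _
    rw [← neg_sub]
    exact (tendsto_rpow_neg_atTop (by linarith)).comp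
      (Filter.tendsto_atTop_add_const_left _ _ Filter.tendsto_id)
  rw [integral_Ioi_of_hasDerivAt_of_tendsto' hd hint ht, add_zero, zero_div, zero_sub,
    ← div_neg, neg_sub]

lemma heat_mul_heat {s τ : ℝ} (hs : 0 < s) (hτ : 0 < τ) (x y z : E n) :
    heat s (y - x) * heat τ (y - z) =
      heat (s + τ) (x - z) * heat (s * τ / (s + τ)) (y - ((s + τ)⁻¹ • (τ • x + s • z))) := by
  have hst : 0 < s + τ := by positivity
  have hne : s + τ ≠ 0 := hst.ne'
  have e1 : ‖y - x‖ ^ 2 / (4 * s) + ‖y - z‖ ^ 2 / (4 * τ) = ‖x - z‖ ^ 2 / (4 * (s + τ)) +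
      ‖y - ((s + τ)⁻¹ • (τ • x + s • z))‖ ^ 2 / (4 * (s * τ / (s + τ))) := by
    have h1 : y - ((s + τ)⁻¹ • (τ • x + s • z)) =
        (s + τ)⁻¹ • (τ • (y - x) + s • (y - z)) := by
      have : y = (s + τ)⁻¹ • ((s + τ) • y) := by rw [smul_smul, inv_mul_cancel₀ hne, one_smul]
      nth_rw 1 [this]
      rw [← smul_sub]
      congr 1
      module
    have h2 : x - z = (y - z) - (y - x) := by abel
    rw [h1, h2]
    generalize y - x = a
    generalize y - z = b
    rw [norm_smul, mul_pow, norm_inv, norm_of_nonneg hst.le,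
      @norm_add_sq_real, @norm_sub_sq_real, norm_smul, norm_smul, inner_smul_left,
      inner_smul_right, norm_of_nonneg hs.le, norm_of_nonneg hτ.le, real_inner_comm]
    simp only [conj_trivial]
    field_simp
    ring
  simp only [heat]
  have e2 : (4 * π * s) ^ (-((n : ℝ) / 2)) * (4 * π * τ) ^ (-((n : ℝ) / 2)) =
      (4 * π * (s + τ)) ^ (-((n : ℝ) / 2)) * (4 * π * (s * τ / (s + τ))) ^ (-((n : ℝ) / 2)) := by
    rw [← mul_rpow (by positivity) (by positivity), ← mul_rpow (by positivity) (by positivity)]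
    congr 1
    field_simp
  rw [mul_mul_mul_comm, ← exp_add, e2, mul_mul_mul_comm ((4 * π * (s + τ)) ^ _) , ← exp_add,
    ← neg_add, e1, neg_add]

lemma integral_heat_mul_heat {s τ : ℝ} (hs : 0 < s) (hτ : 0 < τ) (x z : E n) :
    ∫ y, heat s (y - x) * heat τ (y - z) = heat (s + τ) (x - z) := by
  simp_rw [heat_mul_heat hs hτ, integral_const_mul]
  rw [integral_heat (by positivity), mul_one]

lemma heat_sub_comm (τ : ℝ) (x y : E n) : heat τ (x - y) = heat τ (y - x) := by
  rw [heat, heat, norm_sub_rev]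

lemma integrable_heat_add_prod (hn : 3 ≤ n) {s : ℝ} (hs : 0 < s) (μ : Measure (E n))
    [IsFiniteMeasure μ] (x : E n) :
    Integrable (fun p : E n × ℝ => heat (s + p.2) (x - p.1))
      (μ.prod (volume.restrict (Set.Ioi 0))) := by
  have hm : Measurable fun p : E n × ℝ => heat (s + p.2) (x - p.1) :=
    measurable_heat.comp ((measurable_snd.const_add s).prodMk (measurable_fst.const_sub x))
  have hdom : IntegrableOn (fun τ : ℝ => (s + τ) ^ (-((n : ℝ) / 2))) (Set.Ioi 0) := by
    simp_rw [add_comm s]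
    exact integrableOn_add_rpow_Ioi_of_lt (by linarith [half_dim_sub_one_pos hn]) (by linarith)
  have h := (integrable_const (μ := μ) (1 : ℝ)).mul_prod hdom
  refine h.mono' hm.aestronglyMeasurable ?_
  have hae : ∀ᵐ p ∂(μ.prod (volume.restrict (Set.Ioi (0 : ℝ)))), p.2 ∈ Set.Ioi (0 : ℝ) :=
    Measure.quasiMeasurePreserving_snd.ae (ae_restrict_mem measurableSet_Ioi)
  filter_upwards [hae] with p hp
  have hp : 0 < p.2 := hp
  rw [one_mul, norm_of_nonneg (heat_nonneg (by positivity) _)]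
  exact heat_le (by positivity) _

/-- A heat-kernel bound on `μ` bounds the heat regularisation of its Newtonian potential. -/
lemma integral_heat_mul_newtonianPotential_le (hn : 3 ≤ n) (μ : Measure (E n))
    [IsFiniteMeasure μ] {q K : ℝ} (hq : 1 < q)
    (hμ : ∀ τ > 0, ∀ x, ∫ z, heat τ (x - z) ∂μ ≤ K * τ ^ (-q)) {s : ℝ} (hs : 0 < s) (x : E n) :
    ∫ y, heat s (y - x) * newtonianPotential μ y ≤ K * (s ^ (1 - q) / (q - 1)) := by
  have hM : ∀ y : E n, |heat s (y - x)| ≤ s ^ (-((n : ℝ) / 2)) := fun y => by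
    rw [abs_of_nonneg (heat_nonneg hs _)]; exact heat_le hs _
  rw [integral_mul_newtonianPotential hn (integrable_heat hs x) hM]
  have h1 : ∀ z : E n, ∫ y, heat s (y - x) * newtonKernel (y - z) =
      ∫ τ in Set.Ioi (0 : ℝ), heat (s + τ) (x - z) := by
    intro z
    rw [integral_mul_newtonKernel hn (integrable_heat hs x) hM]
    exact setIntegral_congr_fun measurableSet_Ioi fun τ hτ => integral_heat_mul_heat hs hτ x z
  simp_rw [h1]
  have hint := integrable_heat_add_prod hn hs μ x
  rw [integral_integral_swap hint, ← integral_add_rpow_neg hq hs, ← integral_const_mul]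
  refine setIntegral_mono_on hint.integral_prod_right ?_ measurableSet_Ioi fun τ hτ => ?_
  · refine Integrable.const_mul ?_ _
    simp_rw [add_comm s]
    exact integrableOn_add_rpow_Ioi_of_lt (by linarith) (by linarith)
  · have hτ : 0 < τ := hτ
    exact hμ _ (by positivity) x

lemma measurable_newtonianPotential (μ : Measure (E n)) [IsFiniteMeasure μ] :
    AEStronglyMeasurable (newtonianPotential μ) volume := by
  have h : Measurable fun p : E n × E n => newtonKernel (p.1 - p.2) :=
    measurable_newtonKernel.comp (measurable_fst.sub measurable_snd)
  have := h.stronglyMeasurable.integral_prod_right' (ν := μ)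
  refine this.aestronglyMeasurable.congr (ae_of_all _ fun x => ?_)
  rw [newtonianPotential_eq]

end Trace

section Trace

variable {n : ℕ}

lemma integral_prod_mul_heat_le {s : ℝ} (hs : 0 < s) {f W : E n → ℝ}
    (hf : AEStronglyMeasurable f) (hW : AEStronglyMeasurable W) (hW0 : ∀ x, 0 ≤ W x)
    (hint : ∀ x, Integrable fun y => heat s (y - x) * W y) {B : ℝ}
    (hB : ∀ x, ∫ y, heat s (y - x) * W y ≤ B) (hfW : Integrable fun x => f x ^ 2 * W x) :
    ∫ p : E n × E n, (f p.1 * W p.1) * (f p.2 * W p.2) * heat s (p.1 - p.2) ≤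
      B * ∫ x, f x ^ 2 * W x := by
  have hh : Measurable fun p : E n × E n => heat s (p.1 - p.2) :=
    measurable_heat.comp (measurable_const.prodMk (measurable_fst.sub measurable_snd))
  set F : E n × E n → ℝ := fun p => (f p.1 ^ 2 * W p.1) * (heat s (p.2 - p.1) * W p.2) with hF
  have hFm : AEStronglyMeasurable F (volume.prod volume) := by
    refine hfW.aestronglyMeasurable.comp_fst.mul (AEStronglyMeasurable.mul ?_ hW.comp_snd)
    simp_rw [heat_sub_comm s (Prod.snd _)]
    exact hh.aestronglyMeasurable
  have hnn : ∀ p, 0 ≤ F p := fun p =>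
    mul_nonneg (mul_nonneg (sq_nonneg _) (hW0 _)) (mul_nonneg (heat_nonneg hs _) (hW0 _))
  have hFi : Integrable F (volume.prod volume) := by
    refine (integrable_prod_iff hFm).mpr ⟨ae_of_all _ fun x => (hint x).const_mul (f x ^ 2 * W x), ?_⟩
    refine (hfW.mul_const B).mono' hFm.norm.integral_prod_right' (ae_of_all _ fun x => ?_)
    rw [norm_of_nonneg (integral_nonneg fun _ => norm_nonneg _)]
    simp_rw [fun y => norm_of_nonneg (hnn (x, y)), hF, integral_const_mul]
    exact mul_le_mul_of_nonneg_left (hB x) (mul_nonneg (sq_nonneg _) (hW0 _))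
  have hFs : Integrable (fun p => F p.swap) (volume.prod volume) := hFi.swap
  have hI : ∫ p, F p ∂(volume.prod volume) ≤ B * ∫ x, f x ^ 2 * W x := by
    rw [integral_prod _ hFi, mul_comm, ← integral_mul_const]
    refine integral_mono hFi.integral_prod_left (hfW.mul_const B) fun x => ?_
    simp only [hF, integral_const_mul]
    exact mul_le_mul_of_nonneg_left (hB x) (mul_nonneg (sq_nonneg _) (hW0 _))
  have hIs : ∫ p, F p.swap ∂(volume.prod volume) = ∫ p, F p ∂(volume.prod volume) :=
    integral_prod_swap F
  have hpt : ∀ p : E n × E n, |(f p.1 * W p.1) * (f p.2 * W p.2) * heat s (p.1 - p.2)| ≤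
      (1 / 2) * (F p + F p.swap) := by
    intro p
    have h1 : 0 ≤ W p.1 * W p.2 * heat s (p.1 - p.2) :=
      mul_nonneg (mul_nonneg (hW0 _) (hW0 _)) (heat_nonneg hs _)
    have h2 : |f p.1 * f p.2| ≤ (1 / 2) * (f p.1 ^ 2 + f p.2 ^ 2) := by
      rw [abs_mul]
      nlinarith [sq_nonneg (|f p.1| - |f p.2|), sq_abs (f p.1), sq_abs (f p.2)]
    have h3 := mul_le_mul_of_nonneg_right h2 h1
    have h4 : (f p.1 * W p.1) * (f p.2 * W p.2) * heat s (p.1 - p.2) =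
        (f p.1 * f p.2) * (W p.1 * W p.2 * heat s (p.1 - p.2)) := by ring
    rw [h4, abs_mul, abs_of_nonneg h1]
    refine h3.trans (le_of_eq ?_)
    simp only [hF, Prod.fst_swap, Prod.snd_swap, heat_sub_comm s p.2 p.1]
    ring
  have hm : AEStronglyMeasurable (fun p : E n × E n =>
      (f p.1 * W p.1) * (f p.2 * W p.2) * heat s (p.1 - p.2)) (volume.prod volume) :=
    ((hf.mul hW).comp_fst.mul (hf.mul hW).comp_snd).mul hh.aestronglyMeasurable
  have hdi := (hFi.add hFs).const_mul (1 / 2 : ℝ)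
  rw [Measure.volume_eq_prod]
  calc _ ≤ ∫ p, (1 / 2) * (F p + F p.swap) ∂(volume.prod volume) :=
        integral_mono (hdi.mono' hm (ae_of_all _ hpt)) hdi fun p => (le_abs_self _).trans (hpt p)
    _ = ∫ p, F p ∂(volume.prod volume) := by
        rw [integral_const_mul, integral_add hFi hFs, hIs]; ring
    _ ≤ _ := hI

lemma integral_normSq_synth_mul_exp {A : E n → ℝ} (hA : Integrable A) {v : ℝ} (hv : 0 < v) :
    ∫ ξ : E n, ‖synth A ξ‖ ^ 2 * exp (-v * ‖ξ‖ ^ 2) =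
      ∫ p : E n × E n, A p.1 * A p.2 * heat (v / (4 * π ^ 2)) (p.1 - p.2) := by
  have h := integral_normSq_synth_mul_gaussian hA hv 0
  simp only [sub_zero, inner_zero_left, mul_zero, cos_zero, one_mul] at h
  rw [h, ← integral_const_mul]
  congr 1 with p
  rw [heat, show 4 * π * (v / (4 * π ^ 2)) = (π / v)⁻¹ by field_simp,
    inv_rpow (by positivity), rpow_neg (by positivity), inv_inv,
    show ‖p.1 - p.2‖ ^ 2 / (4 * (v / (4 * π ^ 2))) = π ^ 2 * ‖p.1 - p.2‖ ^ 2 / v by field_simp]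
  ring

lemma rpow_neg_eq_integral {σ a : ℝ} (hσ : 0 < σ) (ha : 0 ≤ a) :
    (1 + a) ^ (-σ) = (Real.Gamma σ)⁻¹ *
      ∫ v in Set.Ioi (0 : ℝ), v ^ (σ - 1) * exp (-v) * exp (-v * a) := by
  have h := integral_rpow_mul_exp_neg_mul_Ioi hσ (show 0 < 1 + a by positivity)
  have h2 : ∀ v : ℝ, v ^ (σ - 1) * exp (-v) * exp (-v * a) = v ^ (σ - 1) * exp (-((1 + a) * v)) := by
    intro v
    rw [mul_assoc, ← exp_add]
    ring_nf
  simp_rw [h2]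
  rw [h, one_div, inv_rpow (by positivity), rpow_neg (by positivity)]
  have := (Real.Gamma_pos_of_pos hσ).ne'
  field_simp

/-- Weighted `L²` bound with a negative Bessel weight from Gaussian-weighted bounds. -/
lemma integral_bessel_mul_le {F : E n → ℝ} (hF : AEStronglyMeasurable F) (hF0 : ∀ ξ, 0 ≤ F ξ)
    {σ q c : ℝ} (hσ : 0 < σ) (hσq : q - 1 < σ)
    (hint : ∀ v > 0, Integrable fun ξ => F ξ * exp (-v * ‖ξ‖ ^ 2))
    (hle : ∀ v > 0, ∫ ξ, F ξ * exp (-v * ‖ξ‖ ^ 2) ≤ c * v ^ (1 - q)) :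
    Integrable (fun ξ => (1 + ‖ξ‖ ^ 2) ^ (-σ) * F ξ) ∧
      ∫ ξ, (1 + ‖ξ‖ ^ 2) ^ (-σ) * F ξ ≤ c * (Real.Gamma (σ - q + 1) / Real.Gamma σ) := by
  set Φ : E n × ℝ → ℝ := fun p => p.2 ^ (σ - 1) * exp (-p.2) * (F p.1 * exp (-p.2 * ‖p.1‖ ^ 2))
    with hΦ
  have hΦm : AEStronglyMeasurable Φ (volume.prod (volume.restrict (Set.Ioi 0))) := by
    refine AEStronglyMeasurable.mul ?_ (hF.comp_fst.mul ?_)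
    · have : Measurable fun p : E n × ℝ => p.2 ^ (σ - 1) * exp (-p.2) := by fun_prop
      exact this.aestronglyMeasurable
    · have : Measurable fun p : E n × ℝ => exp (-p.2 * ‖p.1‖ ^ 2) := by fun_prop
      exact this.aestronglyMeasurable
  have hΦ0 : ∀ ξ, ∀ v > 0, 0 ≤ Φ (ξ, v) := fun ξ v hv => by
    have := hF0 ξ
    simp only [hΦ]
    positivity
  have hdom : IntegrableOn (fun v : ℝ => c * (exp (-v) * v ^ (σ - q + 1 - 1))) (Set.Ioi 0) :=
    (Real.GammaIntegral_convergent (by linarith)).const_mul c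
  have hbd : ∀ v > 0, ∫ ξ, Φ (ξ, v) ≤ c * (exp (-v) * v ^ (σ - q + 1 - 1)) := by
    intro v hv
    simp only [hΦ, integral_const_mul]
    refine (mul_le_mul_of_nonneg_left (hle v hv) (by positivity)).trans (le_of_eq ?_)
    rw [show σ - q + 1 - 1 = (σ - 1) + (1 - q) by ring, rpow_add hv]
    ring
  have hΦi : Integrable Φ (volume.prod (volume.restrict (Set.Ioi 0))) := by
    refine (integrable_prod_iff' hΦm).mpr ⟨?_, ?_⟩
    · exact (ae_restrict_iff' measurableSet_Ioi).mpr
        (ae_of_all _ fun v hv => (hint v hv).const_mul (v ^ (σ - 1) * exp (-v)))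
    · refine hdom.mono' hΦm.norm.prod_swap.integral_prod_right' ?_
      refine (ae_restrict_iff' measurableSet_Ioi).mpr (ae_of_all _ fun v hv => ?_)
      rw [norm_of_nonneg (integral_nonneg fun _ => norm_nonneg _)]
      refine le_trans (le_of_eq ?_) (hbd v hv)
      congr 1 with ξ
      exact norm_of_nonneg (hΦ0 ξ v hv)
  have hG := Real.Gamma_pos_of_pos hσ
  have hpt : ∀ ξ : E n, (1 + ‖ξ‖ ^ 2) ^ (-σ) * F ξ =
      (Real.Gamma σ)⁻¹ * ∫ v in Set.Ioi (0 : ℝ), Φ (ξ, v) := by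
    intro ξ
    rw [rpow_neg_eq_integral hσ (by positivity), mul_assoc, ← integral_mul_const]
    simp only [hΦ]
    congr 2 with v
    ring
  refine ⟨?_, ?_⟩
  · simp_rw [hpt]
    exact hΦi.integral_prod_left.const_mul _
  · simp_rw [hpt]
    rw [integral_const_mul, integral_integral_swap hΦi]
    have h1 : ∫ v in Set.Ioi (0 : ℝ), ∫ ξ, Φ (ξ, v) ≤ c * Real.Gamma (σ - q + 1) := by
      rw [Real.Gamma_eq_integral (by linarith), ← integral_const_mul]
      exact setIntegral_mono_on hΦi.integral_prod_right hdom measurableSet_Ioi hbd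
    calc _ ≤ (Real.Gamma σ)⁻¹ * (c * Real.Gamma (σ - q + 1)) :=
          mul_le_mul_of_nonneg_left h1 (by positivity)
      _ = _ := by ring

lemma integral_synth_mul {g A : E n → ℝ} (hg : Integrable g) (hA : Integrable A) :
    ∫ x, synth g x * (A x : ℂ) = ∫ ξ, (g ξ : ℂ) * synth A ξ := by
  have hi : Integrable (fun p : E n × E n =>
      Complex.exp (((2 * π * ⟪p.1, p.2⟫ : ℝ) : ℂ) * Complex.I) * ((A p.1 : ℂ) * (g p.2 : ℂ)))
      (volume.prod volume) := by
    refine (hA.ofReal.mul_prod hg.ofReal).bdd_mul (c := 1) (by fun_prop)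
      (ae_of_all _ fun p => ?_)
    rw [Complex.norm_exp_ofReal_mul_I]
  have h := integral_integral_swap (f := fun x ξ : E n =>
    Complex.exp (((2 * π * ⟪x, ξ⟫ : ℝ) : ℂ) * Complex.I) * ((A x : ℂ) * (g ξ : ℂ))) hi
  refine Eq.trans ?_ (h.trans ?_)
  · congr 1 with x
    rw [synth, ← integral_mul_const]
    congr 1 with ξ
    ring
  · congr 1 with ξ
    rw [synth, ← integral_const_mul]
    congr 1 with x
    rw [real_inner_comm]
    ring

/-- The constant in the trace inequality. -/
def traceConst (q σ : ℝ) : ℝ :=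
  (4 * π ^ 2) ^ (q - 1) / (q - 1) * (Real.Gamma (σ - q + 1) / Real.Gamma σ)

lemma traceConst_pos {q σ : ℝ} (hq : 1 < q) (hσ : q - 1 < σ) : 0 < traceConst q σ := by
  have h1 := Real.Gamma_pos_of_pos (show 0 < σ - q + 1 by linarith)
  have h2 := Real.Gamma_pos_of_pos (show 0 < σ by linarith)
  have h3 : 0 < q - 1 := by linarith
  unfold traceConst
  positivity

lemma integrable_normSq_synth_mul_exp {A : E n → ℝ} (hA : Integrable A) {v : ℝ} (hv : 0 < v) :
    Integrable fun ξ : E n => ‖synth A ξ‖ ^ 2 * exp (-v * ‖ξ‖ ^ 2) := by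
  have h := integrable_gaussian hv (0 : E n)
  simp only [sub_zero] at h
  refine h.bdd_mul (c := (∫ ξ, |A ξ|) ^ 2)
    ((continuous_synth hA).norm.pow 2).aestronglyMeasurable (ae_of_all _ fun ξ => ?_)
  rw [norm_pow, norm_norm]
  exact pow_le_pow_left₀ (norm_nonneg _) (norm_synth_le ξ) 2

/-- The trace inequality with weight the Newtonian potential of a measure satisfying a
heat-kernel bound. -/
lemma integral_normSq_synth_mul_newtonianPotential_le (hn : 3 ≤ n) (μ : Measure (E n))
    [IsFiniteMeasure μ] {q σ K : ℝ} (hq : 1 < q) (hσ : q - 1 < σ) (hK : 0 ≤ K)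
    (hμ : ∀ τ > 0, ∀ x, ∫ z, heat τ (x - z) ∂μ ≤ K * τ ^ (-q)) {g : E n → ℝ}
    (hg : Integrable g) (hgi : Integrable (synth g)) (hre : ∀ x, (synth g x).im = 0)
    (hgσ : Integrable fun ξ => (1 + ‖ξ‖ ^ 2) ^ σ * g ξ ^ 2) :
    ∫ x, ‖synth g x‖ ^ 2 * newtonianPotential μ x ≤
      traceConst q σ * K * ∫ ξ, (1 + ‖ξ‖ ^ 2) ^ σ * g ξ ^ 2 := by
  have hσ0 : 0 < σ := by linarith
  set W := newtonianPotential μ with hW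
  have hWm : AEStronglyMeasurable W := measurable_newtonianPotential μ
  have hW0 : ∀ x, 0 ≤ W x := newtonianPotential_nonneg hn μ
  set f : E n → ℝ := fun x => (synth g x).re with hf
  have hfi : Integrable f := hgi.re
  set M := ∫ ξ, |g ξ| with hM
  have hfM : ∀ x, |f x| ≤ M := fun x => (Complex.abs_re_le_norm _).trans (norm_synth_le x)
  have hfs : ∀ x, (f x : ℂ) = synth g x := fun x => Complex.ext (by simp [f]) (by simp [hre x])
  have hf2 : ∀ x, ‖synth g x‖ ^ 2 = f x ^ 2 := fun x => by
    rw [← hfs, Complex.norm_real, norm_eq_abs, sq_abs]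
  have hA : Integrable fun x => f x * W x := integrable_mul_newtonianPotential hn hfi hfM μ
  have hf2W : Integrable fun x => f x ^ 2 * W x := by
    have := hA.bdd_mul (c := M) hfi.aestronglyMeasurable (ae_of_all _ hfM)
    refine this.congr (ae_of_all _ fun x => ?_)
    ring
  simp_rw [hf2]
  set X := ∫ x, f x ^ 2 * W x with hX
  have hX0 : 0 ≤ X := integral_nonneg fun x => mul_nonneg (sq_nonneg _) (hW0 x)
  set G := ∫ ξ, (1 + ‖ξ‖ ^ 2) ^ σ * g ξ ^ 2 with hG
  set A : E n → ℝ := fun x => f x * W x with hAdef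
  set c := X * K * ((4 * π ^ 2) ^ (q - 1) / (q - 1)) with hc
  have hgauss : ∀ v > 0, ∫ ξ, ‖synth A ξ‖ ^ 2 * exp (-v * ‖ξ‖ ^ 2) ≤ c * v ^ (1 - q) := by
    intro v hv
    have hs : 0 < v / (4 * π ^ 2) := by positivity
    rw [integral_normSq_synth_mul_exp hA hv]
    have h := integral_prod_mul_heat_le hs hfi.aestronglyMeasurable hWm hW0
      (fun x => integrable_mul_newtonianPotential hn (integrable_heat hs x)
        (M := (v / (4 * π ^ 2)) ^ (-((n : ℝ) / 2)))
        (fun y => by rw [abs_of_nonneg (heat_nonneg hs _)]; exact heat_le hs _) μ)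
      (integral_heat_mul_newtonianPotential_le hn μ hq hμ hs) hf2W
    refine h.trans (le_of_eq ?_)
    rw [div_rpow hv.le (by positivity), ← neg_sub q 1, rpow_neg (by positivity : 0 ≤ 4 * π ^ 2),
      hc, hX]
    field_simp
  obtain ⟨hBi, hB⟩ := integral_bessel_mul_le (F := fun ξ => ‖synth A ξ‖ ^ 2)
    ((continuous_synth hA).norm.pow 2).aestronglyMeasurable (fun ξ => sq_nonneg _) hσ0 hσ
    (fun v hv => integrable_normSq_synth_mul_exp hA hv) hgauss
  set D := ∫ ξ, (1 + ‖ξ‖ ^ 2) ^ (-σ) * ‖synth A ξ‖ ^ 2 with hD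
  have hB' : D ≤ traceConst q σ * K * X := hB.trans (le_of_eq (by rw [hc, traceConst]; ring))
  have hdual : ∀ l > 0, X ≤ (1 / 2) * (l * G + l⁻¹ * D) := by
    intro l hl
    have h1 : (X : ℂ) = ∫ ξ, (g ξ : ℂ) * synth A ξ := by
      rw [← integral_synth_mul hg hA, hX]
      refine (integral_ofReal (𝕜 := ℂ)).symm.trans ?_
      congr 1 with x
      change ((f x ^ 2 * W x : ℝ) : ℂ) = _
      rw [← hfs]
      push_cast [hAdef]
      ring
    have h2 : X ≤ ∫ ξ, |g ξ| * ‖synth A ξ‖ := by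
      have h3 := norm_integral_le_integral_norm (μ := volume) (fun ξ => (g ξ : ℂ) * synth A ξ)
      rw [← h1, Complex.norm_real] at h3
      refine (le_abs_self _).trans (h3.trans (le_of_eq ?_))
      simp_rw [norm_mul, Complex.norm_real, norm_eq_abs]
    refine h2.trans ?_
    have hsum := ((hgσ.const_mul l).add (hBi.const_mul l⁻¹)).const_mul (1 / 2 : ℝ)
    have h4 : (1 / 2) * (l * G + l⁻¹ * D) = ∫ ξ, (1 / 2) * (l * ((1 + ‖ξ‖ ^ 2) ^ σ * g ξ ^ 2) +
        l⁻¹ * ((1 + ‖ξ‖ ^ 2) ^ (-σ) * ‖synth A ξ‖ ^ 2)) := by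
      rw [integral_const_mul, integral_add (hgσ.const_mul l) (hBi.const_mul l⁻¹),
        integral_const_mul, integral_const_mul]
    rw [h4]
    refine integral_mono_of_nonneg (ae_of_all _ fun ξ => by positivity) hsum
      (ae_of_all _ fun ξ => ?_)
    have hw : 0 < (1 + ‖ξ‖ ^ 2) ^ σ := by positivity
    simp only [rpow_neg (show 0 ≤ 1 + ‖ξ‖ ^ 2 by positivity)]
    generalize (1 + ‖ξ‖ ^ 2) ^ σ = w at hw
    rw [← sq_abs (g ξ)]
    generalize |g ξ| = a
    generalize ‖synth A ξ‖ = b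
    have h5 : l * (w * a ^ 2) + l⁻¹ * (w⁻¹ * b ^ 2) - 2 * (a * b) =
        (l * w)⁻¹ * (l * w * a - b) ^ 2 := by
      field_simp
      ring
    have h6 : 0 ≤ (l * w)⁻¹ * (l * w * a - b) ^ 2 := by positivity
    linarith
  have hT := traceConst_pos hq hσ
  have hkey : ∀ ε > 0, X ≤ (traceConst q σ * K + ε) * G := by
    intro ε hε
    have hl : 0 < traceConst q σ * K + ε := by positivity
    have h1 := hdual _ hl
    have h2 : (traceConst q σ * K + ε)⁻¹ * D ≤ X := by
      rw [inv_mul_le_iff₀ hl]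
      nlinarith
    linarith
  have hG0 : 0 ≤ G := integral_nonneg fun ξ => by positivity
  refine le_of_forall_pos_le_add fun ε hε => ?_
  have h1 := hkey (ε / (G + 1)) (by positivity)
  have h2 : ε / (G + 1) * G ≤ ε := by
    rw [div_mul_eq_mul_div, div_le_iff₀ (by positivity)]
    nlinarith
  linarith

end Trace

section Frostman

variable {n : ℕ}

lemma measureReal_ball_le_frostman {μ : Measure (E n)} [IsFiniteMeasure μ] {α : ℝ}
    (hF : frostman μ α < ⊤) (x : E n) {r : ℝ} (hr : 0 < r) :
    μ.real (ball x r) ≤ (frostman μ α).toReal * r ^ α := by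
  have h1 : μ (ball x r) / ENNReal.ofReal (r ^ α) ≤ frostman μ α :=
    le_iSup_of_le x (le_iSup_of_le r (le_iSup_of_le hr le_rfl))
  have hp : 0 < r ^ α := rpow_pos_of_pos hr α
  have h2 := ENNReal.toReal_mono hF.ne h1
  rw [ENNReal.toReal_div, ENNReal.toReal_ofReal hp.le, div_le_iff₀ hp] at h2
  exact h2

lemma measureReal_ball_le_of_le {μ : Measure (E n)} [IsFiniteMeasure μ] {α β R : ℝ}
    (hF : frostman μ α < ⊤) (hβ : 0 < β) (hβα : β ≤ α) (hR : 0 < R)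
    (hμ : μ (ball (0 : E n) R)ᶜ = 0) (x : E n) {r : ℝ} (hr : 0 < r) :
    μ.real (ball x r) ≤ (frostman μ α).toReal * R ^ (α - β) * r ^ β := by
  have hF0 : 0 ≤ (frostman μ α).toReal := ENNReal.toReal_nonneg
  rw [mul_assoc]
  rcases le_or_gt r R with h | h
  · refine (measureReal_ball_le_frostman hF x hr).trans (mul_le_mul_of_nonneg_left ?_ hF0)
    rw [← sub_add_cancel α β, rpow_add hr, add_sub_cancel_right]
    gcongr
  · have h1 : μ.real (ball x r) ≤ μ.real (ball (0 : E n) R) := by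
      have h2 : μ.real (ball x r) ≤ μ.real Set.univ := measureReal_mono (Set.subset_univ _)
      have h3 : μ.real Set.univ ≤ μ.real (ball (0 : E n) R) + μ.real (ball (0 : E n) R)ᶜ := by
        rw [← Set.union_compl_self (ball (0 : E n) R)]
        exact measureReal_union_le _ _
      have h4 : μ.real (ball (0 : E n) R)ᶜ = 0 := by rw [measureReal_def, hμ, ENNReal.toReal_zero]
      linarith
    refine h1.trans ((measureReal_ball_le_frostman hF 0 hR).trans
      (mul_le_mul_of_nonneg_left ?_ hF0))
    nth_rw 1 [← sub_add_cancel α β, rpow_add hR]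
    gcongr

lemma summable_exp_neg_sq_mul_rpow (β : ℝ) :
    Summable fun k : ℕ => exp (-(k : ℝ) ^ 2) * ((k : ℝ) + 1) ^ β := by
  have h := (summable_nat_add_iff 1).mpr
    (Real.summable_pow_mul_exp_neg_nat_mul ⌈β⌉₊ one_pos)
  refine Summable.of_nonneg_of_le (fun k => by positivity) (fun k => ?_) (h.mul_left (exp 1))
  have h1 : ((k : ℝ) + 1) ^ β ≤ ((k : ℝ) + 1) ^ ⌈β⌉₊ := by
    rw [← rpow_natCast]
    exact rpow_le_rpow_of_exponent_le (by linarith [Nat.cast_nonneg (α := ℝ) k]) (Nat.le_ceil β)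
  have h2 : exp (-(k : ℝ) ^ 2) ≤ exp 1 * exp (-1 * ((k + 1 : ℕ) : ℝ)) := by
    rw [← exp_add]
    refine exp_le_exp.mpr ?_
    push_cast
    have : (k : ℝ) ≤ (k : ℝ) ^ 2 := by exact_mod_cast Nat.le_self_pow two_ne_zero k
    linarith
  calc _ ≤ exp 1 * exp (-1 * ((k + 1 : ℕ) : ℝ)) * ((k : ℝ) + 1) ^ ⌈β⌉₊ := by gcongr
    _ = _ := by push_cast; ring

lemma integral_exp_neg_le_of_ball {μ : Measure (E n)} [IsFiniteMeasure μ] {β B : ℝ}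
    (hB : 0 ≤ B) (x : E n) (hμ : ∀ r > 0, μ.real (ball x r) ≤ B * r ^ β) {ρ : ℝ} (hρ : 0 < ρ) :
    ∫ z, exp (-(‖x - z‖ ^ 2 / ρ ^ 2)) ∂μ ≤
      B * ρ ^ β * ∑' k : ℕ, exp (-(k : ℝ) ^ 2) * ((k : ℝ) + 1) ^ β := by
  have hS := summable_exp_neg_sq_mul_rpow β
  have hS0 : 0 ≤ ∑' k : ℕ, exp (-(k : ℝ) ^ 2) * ((k : ℝ) + 1) ^ β :=
    tsum_nonneg fun k => by positivity
  rw [integral_eq_lintegral_of_nonneg_ae (ae_of_all _ fun z => by positivity)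
    (by fun_prop)]
  refine ENNReal.toReal_le_of_le_ofReal (by positivity) ?_
  have hpt : ∀ z, ENNReal.ofReal (exp (-(‖x - z‖ ^ 2 / ρ ^ 2))) ≤
      ∑' k : ℕ, (ball x (ρ * ((k : ℝ) + 1))).indicator
        (fun _ => ENNReal.ofReal (exp (-(k : ℝ) ^ 2))) z := by
    intro z
    set k := ⌊‖x - z‖ / ρ⌋₊ with hk
    have hk1 : (k : ℝ) ≤ ‖x - z‖ / ρ := Nat.floor_le (by positivity)
    have hk2 : ‖x - z‖ / ρ < k + 1 := Nat.lt_floor_add_one _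
    refine le_trans ?_ (ENNReal.le_tsum k)
    rw [Set.indicator_of_mem]
    · refine ENNReal.ofReal_le_ofReal (exp_le_exp.mpr (neg_le_neg ?_))
      rw [← div_pow]
      gcongr
    · rw [div_lt_iff₀ hρ] at hk2
      rw [mem_ball, dist_comm, dist_eq_norm]
      linarith
  calc _ ≤ ∫⁻ z, ∑' k : ℕ, (ball x (ρ * ((k : ℝ) + 1))).indicator
        (fun _ => ENNReal.ofReal (exp (-(k : ℝ) ^ 2))) z ∂μ := lintegral_mono hpt
    _ = ∑' k : ℕ, ENNReal.ofReal (exp (-(k : ℝ) ^ 2)) * μ (ball x (ρ * ((k : ℝ) + 1))) := by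
        rw [lintegral_tsum fun k => (measurable_const.indicator measurableSet_ball).aemeasurable]
        congr 1 with k
        rw [lintegral_indicator_const measurableSet_ball]
    _ ≤ ∑' k : ℕ, ENNReal.ofReal
          (B * ρ ^ β * (exp (-(k : ℝ) ^ 2) * ((k : ℝ) + 1) ^ β)) := by
        refine ENNReal.tsum_le_tsum fun k => ?_
        have h1 := hμ (ρ * ((k : ℝ) + 1)) (by positivity)
        rw [← ofReal_measureReal, ← ENNReal.ofReal_mul (exp_pos _).le]
        refine ENNReal.ofReal_le_ofReal ?_
        rw [mul_rpow hρ.le (by positivity)] at h1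
        calc _ ≤ exp (-(k : ℝ) ^ 2) * (B * (ρ ^ β * ((k : ℝ) + 1) ^ β)) := by gcongr
          _ = _ := by ring
    _ = ENNReal.ofReal (B * ρ ^ β * ∑' k : ℕ, exp (-(k : ℝ) ^ 2) * ((k : ℝ) + 1) ^ β) := by
        rw [← ENNReal.ofReal_tsum_of_nonneg (fun k => by positivity) (hS.mul_left _),
          tsum_mul_left]

/-- Frostman measures of bounded support satisfy heat-kernel bounds. -/
lemma exists_integral_heat_le_frostman (n : ℕ) {α β R : ℝ} (hβ : 0 < β) (hβα : β ≤ α)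
    (hR : 0 < R) :
    ∃ C₀ : ℝ, 0 < C₀ ∧ ∀ (μ : Measure (E n)) [IsFiniteMeasure μ], frostman μ α < ⊤ →
      μ (ball (0 : E n) R)ᶜ = 0 → ∀ τ > 0, ∀ x,
        ∫ z, heat τ (x - z) ∂μ ≤ C₀ * (frostman μ α).toReal * τ ^ (-(((n : ℝ) - β) / 2)) := by
  have hS := summable_exp_neg_sq_mul_rpow β
  have hSpos : 0 < ∑' k : ℕ, exp (-(k : ℝ) ^ 2) * ((k : ℝ) + 1) ^ β :=
    hS.tsum_pos (fun k => by positivity) 0 (by positivity)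
  set S := ∑' k : ℕ, exp (-(k : ℝ) ^ 2) * ((k : ℝ) + 1) ^ β
  refine ⟨(4 * π) ^ (-((n : ℝ) / 2)) * R ^ (α - β) * 4 ^ (β / 2) * S, by positivity, ?_⟩
  intro μ _ hF hμ τ hτ x
  have hF0 : 0 ≤ (frostman μ α).toReal := ENNReal.toReal_nonneg
  have h := integral_exp_neg_le_of_ball (by positivity) x
    (fun r hr => measureReal_ball_le_of_le hF hβ hβα hR hμ x hr)
    (ρ := √(4 * τ)) (by positivity)
  simp only [heat, integral_const_mul]
  rw [sq_sqrt (by positivity)] at h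
  refine (mul_le_mul_of_nonneg_left h (by positivity)).trans (le_of_eq ?_)
  have h2 : √(4 * τ) ^ β = 4 ^ (β / 2) * τ ^ (β / 2) := by
    rw [sqrt_eq_rpow, ← rpow_mul (by positivity), mul_rpow (by norm_num) hτ.le]
    ring_nf
  rw [h2, mul_rpow (by positivity) hτ.le,
    show -(((n : ℝ) - β) / 2) = -((n : ℝ) / 2) + β / 2 by ring, rpow_add hτ]
  ring

end Frostman

section Amplitude

open scoped ContDiff FourierTransform SchwartzMap

variable {n : ℕ}

/-- Smooth compactly supported frequency profiles that vanish near the origin. -/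
structure IsTestAmplitude (g : E n → ℝ) : Prop where
  contDiff : ContDiff ℝ ∞ g
  hasCompactSupport : HasCompactSupport g
  eventually_eq_zero : ∀ᶠ ξ in nhds 0, g ξ = 0

namespace IsTestAmplitude

variable {g : E n → ℝ}

lemma mul (hg : IsTestAmplitude g) {φ : E n → ℝ} (hφ : ∀ ξ ≠ 0, ContDiffAt ℝ ∞ φ ξ) :
    IsTestAmplitude fun ξ => φ ξ * g ξ where
  contDiff := by
    rw [contDiff_iff_contDiffAt]
    intro ξ
    by_cases h : ξ = 0
    · subst h
      refine (contDiffAt_const (c := (0 : ℝ))).congr_of_eventuallyEq ?_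
      filter_upwards [hg.eventually_eq_zero] with ξ hξ
      rw [hξ, mul_zero]
    · exact (hφ ξ h).mul hg.contDiff.contDiffAt
  hasCompactSupport := hg.hasCompactSupport.mul_left
  eventually_eq_zero := by
    filter_upwards [hg.eventually_eq_zero] with ξ hξ
    rw [hξ, mul_zero]

lemma norm_mul (hg : IsTestAmplitude g) : IsTestAmplitude fun ξ => ‖ξ‖ * g ξ :=
  hg.mul fun _ hξ => contDiffAt_norm ℝ hξ

lemma coord_mul (hg : IsTestAmplitude g) (i : Fin n) : IsTestAmplitude fun ξ => ξ i * g ξ :=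
  hg.mul fun _ _ => (EuclideanSpace.proj (𝕜 := ℝ) i).contDiff.contDiffAt

lemma cos_mul (hg : IsTestAmplitude g) (t : ℝ) :
    IsTestAmplitude fun ξ => cos (2 * π * t * ‖ξ‖) * g ξ :=
  hg.mul fun _ hξ => (contDiffAt_const.mul (contDiffAt_norm ℝ hξ)).cos

lemma sin_mul (hg : IsTestAmplitude g) (t : ℝ) :
    IsTestAmplitude fun ξ => sin (2 * π * t * ‖ξ‖) * g ξ :=
  hg.mul fun _ hξ => (contDiffAt_const.mul (contDiffAt_norm ℝ hξ)).sin

lemma const_mul (hg : IsTestAmplitude g) (c : ℝ) : IsTestAmplitude fun ξ => c * g ξ :=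
  hg.mul fun _ _ => contDiffAt_const

lemma integrable (hg : IsTestAmplitude g) : Integrable g :=
  hg.contDiff.continuous.integrable_of_hasCompactSupport hg.hasCompactSupport

lemma integrable_weight (hg : IsTestAmplitude g) (s : ℝ) :
    Integrable fun ξ => (1 + ‖ξ‖ ^ 2) ^ s * g ξ ^ 2 := by
  refine Continuous.integrable_of_hasCompactSupport ?_ ?_
  · refine Continuous.mul ?_ (hg.contDiff.continuous.pow 2)
    exact Continuous.rpow_const (by fun_prop) fun ξ => Or.inl (by positivity)
  · refine HasCompactSupport.mul_left ?_
    refine hg.hasCompactSupport.mono fun ξ hξ => ?_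
    simpa using hξ

lemma contDiff_ofReal (hg : IsTestAmplitude g) : ContDiff ℝ ∞ fun ξ => (g ξ : ℂ) :=
  Complex.ofRealCLM.contDiff.comp hg.contDiff

lemma hasCompactSupport_ofReal (hg : IsTestAmplitude g) :
    HasCompactSupport fun ξ => (g ξ : ℂ) :=
  hg.hasCompactSupport.comp_left (g := fun r : ℝ => (r : ℂ)) Complex.ofReal_zero

/-- The amplitude as a complex-valued Schwartz function. -/
def toSchwartz (hg : IsTestAmplitude g) : 𝓢(E n, ℂ) :=
  hg.hasCompactSupport_ofReal.toSchwartzMap hg.contDiff_ofReal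

lemma toSchwartz_apply (hg : IsTestAmplitude g) (ξ : E n) : hg.toSchwartz ξ = (g ξ : ℂ) := rfl

lemma fourierInv_toSchwartz (hg : IsTestAmplitude g) (x : E n) :
    𝓕⁻ hg.toSchwartz x = synth g x := by
  rw [SchwartzMap.fourierInv_coe, Real.fourierInv_eq', synth]
  congr 1 with ξ
  rw [real_inner_comm, smul_eq_mul, toSchwartz_apply]

lemma integrable_synth (hg : IsTestAmplitude g) : Integrable (synth g) := by
  rw [← funext hg.fourierInv_toSchwartz]
  exact SchwartzMap.integrable _

lemma integrable_normSq_synth (hg : IsTestAmplitude g) :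
    Integrable fun x => ‖synth g x‖ ^ 2 := by
  rw [← funext hg.fourierInv_toSchwartz]
  set S : 𝓢(E n, ℂ) := 𝓕⁻ hg.toSchwartz
  exact (memLp_two_iff_integrable_sq_norm S.continuous.aestronglyMeasurable).mp (S.memLp 2)

end IsTestAmplitude

lemma synth_neg_of_even {g : E n → ℝ} (he : ∀ ξ, g (-ξ) = g ξ) (x : E n) :
    synth g (-x) = synth g x := by
  rw [synth, ← integral_neg_eq_self, synth]
  congr 1 with ξ
  rw [inner_neg_neg, he]

lemma synth_neg_of_odd {g : E n → ℝ} (ho : ∀ ξ, g (-ξ) = -g ξ) (x : E n) :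
    synth g (-x) = -synth g x := by
  rw [synth, ← integral_neg_eq_self, synth, ← integral_neg]
  congr 1 with ξ
  rw [inner_neg_neg, ho]
  push_cast
  ring

lemma conj_synth (g : E n → ℝ) (x : E n) :
    (starRingEnd ℂ) (synth g x) = synth g (-x) := by
  rw [synth, synth, ← integral_conj]
  congr 1 with ξ
  rw [map_mul, ← Complex.exp_conj, map_mul, Complex.conj_ofReal, Complex.conj_ofReal,
    Complex.conj_I, inner_neg_left]
  congr 2
  push_cast
  ring

lemma synth_im_of_even {g : E n → ℝ} (he : ∀ ξ, g (-ξ) = g ξ) (x : E n) :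
    (synth g x).im = 0 := by
  have h := conj_synth g x
  rw [synth_neg_of_even he] at h
  exact Complex.conj_eq_iff_im.mp h

lemma synth_re_of_odd {g : E n → ℝ} (ho : ∀ ξ, g (-ξ) = -g ξ) (x : E n) :
    (synth g x).re = 0 := by
  have h := congrArg Complex.re (conj_synth g x)
  rw [synth_neg_of_odd ho, Complex.conj_re, Complex.neg_re] at h
  linarith

lemma normSq_synth_add_I_mul_of_even {A B : E n → ℝ} (hA : ∀ ξ, A (-ξ) = A ξ)
    (hB : ∀ ξ, B (-ξ) = B ξ) (x : E n) :
    ‖synth A x + Complex.I * synth B x‖ ^ 2 = ‖synth A x‖ ^ 2 + ‖synth B x‖ ^ 2 := by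
  have h1 := synth_im_of_even hA x
  have h2 := synth_im_of_even hB x
  simp only [← Complex.normSq_eq_norm_sq, Complex.normSq_apply, Complex.add_re, Complex.add_im,
    Complex.mul_re, Complex.mul_im, Complex.I_re, Complex.I_im, h1, h2]
  ring

lemma normSq_synth_add_I_mul_of_odd {A B : E n → ℝ} (hA : ∀ ξ, A (-ξ) = -A ξ)
    (hB : ∀ ξ, B (-ξ) = -B ξ) (x : E n) :
    ‖synth A x + Complex.I * synth B x‖ ^ 2 = ‖synth A x‖ ^ 2 + ‖synth B x‖ ^ 2 := by
  have h1 := synth_re_of_odd hA x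
  have h2 := synth_re_of_odd hB x
  simp only [← Complex.normSq_eq_norm_sq, Complex.normSq_apply, Complex.add_re, Complex.add_im,
    Complex.mul_re, Complex.mul_im, Complex.I_re, Complex.I_im, h1, h2]
  ring

lemma FT_eq_fourier (u₀ : 𝓢(E n, ℂ)) (ξ : E n) : FT u₀ ξ = 𝓕 u₀ ξ := by
  rw [SchwartzMap.fourier_coe, Real.fourier_eq', FT]
  simp_rw [smul_eq_mul]

/-- An even test amplitude is the Fourier transform of a real even Schwartz function. -/
lemma IsTestAmplitude.exists_schwartz {g : E n → ℝ} (hg : IsTestAmplitude g)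
    (he : ∀ ξ, g (-ξ) = g ξ) :
    ∃ u₀ : 𝓢(E n, ℂ), (∀ x, (u₀ x).im = 0) ∧ (∀ x, u₀ (-x) = u₀ x) ∧
      ∀ ξ, FT u₀ ξ = (g ξ : ℂ) := by
  refine ⟨𝓕⁻ hg.toSchwartz, fun x => ?_, fun x => ?_, fun ξ => ?_⟩
  · rw [hg.fourierInv_toSchwartz, synth_im_of_even he]
  · rw [hg.fourierInv_toSchwartz, hg.fourierInv_toSchwartz, synth_neg_of_even he]
  · rw [FT_eq_fourier, FourierTransform.fourier_fourierInv_eq, hg.toSchwartz_apply]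

/-- The Fourier transform of a real even function is real. -/
lemma FT_im_of_even {f : E n → ℂ} (hre : ∀ x, (f x).im = 0) (he : ∀ x, f (-x) = f x) (ξ : E n) :
    (FT f ξ).im = 0 := by
  rw [← Complex.conj_eq_iff_im, FT, ← integral_conj, ← integral_neg_eq_self]
  congr 1 with x
  rw [map_mul, ← Complex.exp_conj, map_mul, Complex.conj_ofReal, Complex.conj_I, he,
    Complex.conj_eq_iff_im.mpr (hre x), inner_neg_left]
  congr 2
  push_cast
  ring

lemma FT_neg_of_even {f : E n → ℂ} (he : ∀ x, f (-x) = f x) (ξ : E n) :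
    FT f (-ξ) = FT f ξ := by
  rw [FT, ← integral_neg_eq_self, FT]
  congr 1 with x
  rw [inner_neg_neg, he]

/-- A half-wave integral with real multiplier `m` splits into cosine and sine parts. -/
lemma integral_mul_exp_wave {m g : E n → ℝ} {t : ℝ}
    (hA : Integrable fun ξ => m ξ * (cos (2 * π * t * ‖ξ‖) * g ξ))
    (hB : Integrable fun ξ => m ξ * (sin (2 * π * t * ‖ξ‖) * g ξ)) (x : E n) :
    ∫ ξ, (m ξ : ℂ) * (Complex.exp (((2 * π * (⟪x, ξ⟫ + t * ‖ξ‖) : ℝ) : ℂ) * Complex.I) * (g ξ : ℂ))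
      = synth (fun ξ => m ξ * (cos (2 * π * t * ‖ξ‖) * g ξ)) x +
        Complex.I * synth (fun ξ => m ξ * (sin (2 * π * t * ‖ξ‖) * g ξ)) x := by
  rw [synth, synth, ← integral_const_mul, ← integral_add (integrable_exp_mul_ofReal hA x)
    ((integrable_exp_mul_ofReal hB x).const_mul _)]
  congr 1 with ξ
  have h1 : (((2 * π * (⟪x, ξ⟫ + t * ‖ξ‖) : ℝ) : ℂ) * Complex.I) =
      ((2 * π * ⟪x, ξ⟫ : ℝ) : ℂ) * Complex.I + ((2 * π * t * ‖ξ‖ : ℝ) : ℂ) * Complex.I := by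
    push_cast
    ring
  rw [h1, Complex.exp_add, Complex.exp_mul_I ((2 * π * t * ‖ξ‖ : ℝ) : ℂ), ← Complex.ofReal_cos,
    ← Complex.ofReal_sin]
  push_cast
  ring

end Amplitude

section Oscillation

lemma integral_cos_eq_sinc (a : ℝ) : ∫ t in (0 : ℝ)..1, cos (2 * π * t * a) = sinc (2 * π * a) := by
  by_cases ha : a = 0
  · simp [ha]
  have h0 : 2 * π * a ≠ 0 := by positivity
  rw [sinc_of_ne_zero h0, show (fun t : ℝ => cos (2 * π * t * a)) = fun t => cos (2 * π * a * t) by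
    ext t; ring_nf, intervalIntegral.integral_comp_mul_left (fun u => cos u) h0]
  simp [div_eq_inv_mul]

lemma integral_fejer_cos_eq_sinc_sq (a : ℝ) :
    ∫ u in (0 : ℝ)..2, (1 - u / 2) * cos (2 * π * u * a) = sinc (2 * π * a) ^ 2 := by
  by_cases ha : a = 0
  · have h : ∀ u ∈ Set.uIcc (0 : ℝ) 2, HasDerivAt (fun u : ℝ => u - u ^ 2 / 4) (1 - u / 2) u := by
      intro u _
      refine ((hasDerivAt_id u).sub ((hasDerivAt_pow 2 u).div_const 4)).congr_deriv ?_
      norm_num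
      ring
    simp only [ha, mul_zero, cos_zero, mul_one, sinc_zero, one_pow]
    rw [intervalIntegral.integral_eq_sub_of_hasDerivAt h
      ((by fun_prop : Continuous fun u : ℝ => 1 - u / 2).intervalIntegrable _ _)]
    norm_num
  set b := 2 * π * a with hb
  have h0 : b ≠ 0 := by positivity
  have h : ∀ u ∈ Set.uIcc (0 : ℝ) 2,
      HasDerivAt (fun u : ℝ => (1 - u / 2) * (sin (b * u) / b) - cos (b * u) / (2 * b ^ 2))
        ((1 - u / 2) * cos (b * u)) u := by
    intro u _
    have hl : HasDerivAt (fun u : ℝ => b * u) b u := by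
      simpa using (hasDerivAt_id u).const_mul b
    have hw : HasDerivAt (fun u : ℝ => 1 - u / 2) (-(1 / 2)) u :=
      ((hasDerivAt_id u).div_const 2).const_sub 1
    refine ((hw.mul (hl.sin.div_const b)).sub (hl.cos.div_const (2 * b ^ 2))).congr_deriv ?_
    field_simp
    ring
  rw [show (fun u : ℝ => (1 - u / 2) * cos (2 * π * u * a)) =
      fun u => (1 - u / 2) * cos (b * u) by ext u; rw [hb]; ring_nf,
    intervalIntegral.integral_eq_sub_of_hasDerivAt h
      ((by fun_prop : Continuous fun u : ℝ => (1 - u / 2) * cos (b * u)).intervalIntegrable _ _),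
    sinc_of_ne_zero h0]
  have h2 : cos (b * 2) = 1 - 2 * sin b ^ 2 := by
    rw [mul_comm, cos_two_mul, cos_sq']; ring
  rw [h2]
  simp only [mul_zero, sin_zero, cos_zero]
  field_simp
  ring

variable {X : Type*} [MeasurableSpace X] {ν : Measure X} {q a : X → ℝ}

lemma integrable_mul_cos (hq : Integrable q ν) (ha : Measurable a) (t : ℝ) :
    Integrable (fun p => q p * cos (2 * π * t * a p)) ν :=
  hq.mul_bdd (c := 1) (by fun_prop) (ae_of_all _ fun p => by simpa using abs_cos_le_one _)

lemma continuous_integral_mul_cos (hq : Integrable q ν) (ha : Measurable a) :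
    Continuous fun t : ℝ => ∫ p, q p * cos (2 * π * t * a p) ∂ν := by
  refine continuous_of_dominated (bound := fun p => |q p|)
    (fun t => (integrable_mul_cos hq ha t).aestronglyMeasurable) (fun t => ae_of_all _ fun p => ?_)
    hq.abs (ae_of_all _ fun p => by fun_prop)
  rw [norm_mul, norm_eq_abs, norm_eq_abs]
  exact mul_le_of_le_one_right (abs_nonneg _) (abs_cos_le_one _)

lemma intervalIntegral_mul_integral_cos [SFinite ν] (hq : Integrable q ν) (ha : Measurable a) {ω : ℝ → ℝ}
    (hω : Continuous ω) {c d : ℝ} (hcd : c ≤ d) :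
    ∫ t in c..d, ω t * ∫ p, q p * cos (2 * π * t * a p) ∂ν =
      ∫ p, q p * (∫ t in c..d, ω t * cos (2 * π * t * a p)) ∂ν := by
  simp_rw [intervalIntegral.integral_of_le hcd, ← integral_const_mul]
  have hωi : Integrable ω (volume.restrict (Set.Ioc c d)) :=
    (hω.integrableOn_Icc).mono_set Set.Ioc_subset_Icc_self
  rw [integral_integral_swap]
  · congr 1 with p
    congr 1 with t
    ring
  · have h := (hωi.mul_prod hq).mul_bdd (c := 1)
      (g := fun z : ℝ × X => cos (2 * π * z.1 * a z.2))
      (by fun_prop) (ae_of_all _ fun z => by simpa using abs_cos_le_one _)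
    refine h.congr (ae_of_all _ fun z => ?_)
    simp only [Function.uncurry]
    ring

end Oscillation

section MeasureTransform

variable {n : ℕ}

/-- The cosine transform `∫ cos(2π y·w) dμ(y)` of a measure. -/
def cosTransform (μ : Measure (E n)) (w : E n) : ℝ := ∫ y, cos (2 * π * ⟪y, w⟫) ∂μ

lemma integrable_mul_cos_inner_prod {B : E n × E n → ℝ} (hB : Integrable B) (μ : Measure (E n))
    [IsFiniteMeasure μ] :
    Integrable (fun z : E n × (E n × E n) => B z.2 * cos (2 * π * ⟪z.1, z.2.1 - z.2.2⟫))
      (μ.prod volume) :=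
  (hB.comp_snd μ).mul_bdd (c := 1) (by fun_prop)
    (ae_of_all _ fun z => by simpa using abs_cos_le_one _)

lemma integral_integral_mul_cos_inner {B : E n × E n → ℝ} (hB : Integrable B) (μ : Measure (E n))
    [IsFiniteMeasure μ] :
    ∫ y, (∫ p, B p * cos (2 * π * ⟪y, p.1 - p.2⟫)) ∂μ =
      ∫ p, B p * cosTransform μ (p.1 - p.2) := by
  rw [integral_integral_swap (f := fun y p => B p * cos (2 * π * ⟪y, p.1 - p.2⟫))
    (integrable_mul_cos_inner_prod hB μ)]
  simp_rw [cosTransform, integral_const_mul]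

lemma integrable_mul_cosTransform {B : E n × E n → ℝ} (hB : Integrable B) (μ : Measure (E n))
    [IsFiniteMeasure μ] :
    Integrable fun p => B p * cosTransform μ (p.1 - p.2) := by
  have h := (integrable_mul_cos_inner_prod hB μ).integral_prod_right
  refine h.congr (ae_of_all _ fun p => ?_)
  simp_rw [cosTransform, integral_const_mul]

end MeasureTransform

section Wave

variable {n : ℕ}

/-- The symbols of `∂_t` (index `none`) and of the components of `∇`, up to a factor `i`. -/
def waveMult : Option (Fin n) → E n → ℝ
  | none, ξ => 2 * π * ‖ξ‖
  | some i, ξ => 2 * π * ξ i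

/-- The signs of the null form `|∂_t u|² - |∇u|²`. -/
def nullSign : Option (Fin n) → ℝ
  | none => 1
  | some _ => -1

/-- `cos` or `sin` of `2πt|ξ|`. -/
def wavePhase (t : ℝ) : Bool → E n → ℝ
  | true, ξ => cos (2 * π * t * ‖ξ‖)
  | false, ξ => sin (2 * π * t * ‖ξ‖)

/-- The amplitudes whose `synth` are the real and imaginary parts of the derivatives of a wave. -/
def waveAmp (h : E n → ℝ) (t : ℝ) (k : Option (Fin n) × Bool) (ξ : E n) : ℝ :=
  waveMult k.1 ξ * (wavePhase t k.2 ξ * h ξ)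

/-- The symbol of the null form divided by `|ξ - η|²`. -/
def nullKernel (p : E n × E n) : ℝ :=
  (‖p.1‖ * ‖p.2‖ - ⟪p.1, p.2⟫) / ‖p.1 - p.2‖ ^ 2

lemma wavePhase_neg (t : ℝ) (b : Bool) (ξ : E n) : wavePhase t b (-ξ) = wavePhase t b ξ := by
  cases b <;> simp [wavePhase]

lemma IsTestAmplitude.wavePhase_mul {h : E n → ℝ} (hh : IsTestAmplitude h) (t : ℝ) (b : Bool) :
    IsTestAmplitude fun ξ => wavePhase t b ξ * h ξ := by
  cases b
  · exact hh.sin_mul t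
  · exact hh.cos_mul t

lemma IsTestAmplitude.waveAmp {h : E n → ℝ} (hh : IsTestAmplitude h) (t : ℝ)
    (k : Option (Fin n) × Bool) : IsTestAmplitude (waveAmp h t k) := by
  have h1 := hh.wavePhase_mul t k.2
  obtain ⟨k, b⟩ := k
  cases k with
  | none =>
    have := h1.norm_mul.const_mul (2 * π)
    simp only [← mul_assoc (2 * π)] at this
    exact this
  | some i =>
    have := (h1.coord_mul i).const_mul (2 * π)
    simp only [← mul_assoc (2 * π)] at this
    exact this

lemma normSq_wave_eq {h : E n → ℝ} (hh : IsTestAmplitude h) (he : ∀ ξ, h (-ξ) = h ξ) (t : ℝ)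
    (k : Option (Fin n)) (x : E n) :
    ‖∫ ξ, ((waveMult k ξ : ℝ) : ℂ) * Complex.I *
      Complex.exp (((2 * π * (⟪x, ξ⟫ + t * ‖ξ‖) : ℝ) : ℂ) * Complex.I) * (h ξ : ℂ)‖ ^ 2 =
    ‖synth (waveAmp h t (k, true)) x‖ ^ 2 + ‖synth (waveAmp h t (k, false)) x‖ ^ 2 := by
  have h1 := integral_mul_exp_wave (m := waveMult k) (hh.waveAmp t (k, true)).integrable
    (hh.waveAmp t (k, false)).integrable x
  have h2 : ∫ ξ, ((waveMult k ξ : ℝ) : ℂ) * Complex.I *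
      Complex.exp (((2 * π * (⟪x, ξ⟫ + t * ‖ξ‖) : ℝ) : ℂ) * Complex.I) * (h ξ : ℂ) =
      Complex.I * (synth (waveAmp h t (k, true)) x +
        Complex.I * synth (waveAmp h t (k, false)) x) := by
    refine Eq.trans ?_ (congrArg (Complex.I * ·) h1)
    rw [← integral_const_mul]
    congr 1 with ξ
    ring
  rw [h2, norm_mul, Complex.norm_I, one_mul]
  cases k with
  | none =>
    refine normSq_synth_add_I_mul_of_even (fun ξ => ?_) (fun ξ => ?_) x <;>
    simp [_root_.waveAmp, waveMult, wavePhase, he]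
  | some i =>
    refine normSq_synth_add_I_mul_of_odd (fun ξ => ?_) (fun ξ => ?_) x <;>
    simp [_root_.waveAmp, waveMult, wavePhase, he]

lemma normSq_halfWave {u₀ : E n → ℂ} {h : E n → ℝ} (hu : ∀ ξ, FT u₀ ξ = (h ξ : ℂ))
    (hh : IsTestAmplitude h) (he : ∀ ξ, h (-ξ) = h ξ) (t : ℝ) (x : E n) :
    ‖halfWave u₀ t x‖ ^ 2 = ∑ b, ‖synth (fun ξ => wavePhase t b ξ * h ξ) x‖ ^ 2 := by
  have h1 := integral_mul_exp_wave (m := fun _ => 1) (g := h) (t := t)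
    (by simpa using (hh.cos_mul t).integrable) (by simpa using (hh.sin_mul t).integrable) x
  simp only [Complex.ofReal_one, one_mul] at h1
  simp_rw [halfWave, hu]
  rw [h1, normSq_synth_add_I_mul_of_even, Fintype.sum_bool]
  · rfl
  · intro ξ; simp [he]
  · intro ξ; simp [he]

lemma nullForm_eq {u₀ : E n → ℂ} {h : E n → ℝ} (hu : ∀ ξ, FT u₀ ξ = (h ξ : ℂ))
    (hh : IsTestAmplitude h) (he : ∀ ξ, h (-ξ) = h ξ) (t : ℝ) (x : E n) :
    ‖dtWave u₀ t x‖ ^ 2 - ∑ i, ‖gradWaveComp u₀ t x i‖ ^ 2 =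
      ∑ k : Option (Fin n) × Bool, nullSign k.1 * ‖synth (waveAmp h t k) x‖ ^ 2 := by
  have h1 : ‖dtWave u₀ t x‖ ^ 2 =
      ‖synth (waveAmp h t (none, true)) x‖ ^ 2 + ‖synth (waveAmp h t (none, false)) x‖ ^ 2 := by
    simp_rw [dtWave, hu]
    exact normSq_wave_eq hh he t none x
  have h2 : ∀ i, ‖gradWaveComp u₀ t x i‖ ^ 2 =
      ‖synth (waveAmp h t (some i, true)) x‖ ^ 2 +
        ‖synth (waveAmp h t (some i, false)) x‖ ^ 2 := fun i => by
    simp_rw [gradWaveComp, hu]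
    exact normSq_wave_eq hh he t (some i) x
  rw [h1, Finset.sum_congr rfl fun i _ => h2 i, Fintype.sum_prod_type, Fintype.sum_option]
  simp only [Fintype.sum_bool, nullSign, one_mul, neg_one_mul, Finset.sum_neg_distrib,
    sub_eq_add_neg]

lemma two_mul_nullSymbol (ξ η : E n) :
    2 * (‖ξ‖ * ‖η‖ - ⟪ξ, η⟫) = ‖ξ - η‖ ^ 2 - (‖ξ‖ - ‖η‖) ^ 2 := by
  rw [@norm_sub_sq_real]
  ring

lemma abs_nullSymbol_le (ξ η : E n) : |‖ξ‖ * ‖η‖ - ⟪ξ, η⟫| ≤ ‖ξ - η‖ ^ 2 / 2 := by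
  rw [abs_of_nonneg (sub_nonneg.mpr (real_inner_le_norm ξ η))]
  nlinarith [two_mul_nullSymbol ξ η, sq_nonneg (‖ξ‖ - ‖η‖)]

lemma abs_nullKernel_le (p : E n × E n) : |nullKernel p| ≤ 1 := by
  rw [nullKernel, abs_div, abs_of_nonneg (sq_nonneg ‖p.1 - p.2‖)]
  refine div_le_one_of_le₀ ((abs_nullSymbol_le _ _).trans ?_) (sq_nonneg _)
  linarith [sq_nonneg ‖p.1 - p.2‖]

lemma measurable_nullKernel : Measurable (nullKernel : E n × E n → ℝ) := by
  unfold nullKernel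
  fun_prop

lemma sum_waveAmp_mul (h : E n → ℝ) (t : ℝ) (p : E n × E n) :
    ∑ k : Option (Fin n) × Bool, nullSign k.1 * (waveAmp h t k p.1 * waveAmp h t k p.2) =
      4 * π ^ 2 * (‖p.1‖ * ‖p.2‖ - ⟪p.1, p.2⟫) * (h p.1 * h p.2) *
        cos (2 * π * t * (‖p.1‖ - ‖p.2‖)) := by
  have hin : ⟪p.1, p.2⟫ = ∑ i, p.1 i * p.2 i := by
    simp [PiLp.inner_apply, mul_comm]
  rw [mul_sub (2 * π * t), cos_sub, hin, Fintype.sum_prod_type, Fintype.sum_option]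
  simp only [Fintype.sum_bool, nullSign, waveAmp, waveMult, wavePhase]
  have : ∀ i : Fin n, -1 * (2 * π * p.1 i * (cos (2 * π * t * ‖p.1‖) * h p.1) *
        (2 * π * p.2 i * (cos (2 * π * t * ‖p.2‖) * h p.2))) +
      -1 * (2 * π * p.1 i * (sin (2 * π * t * ‖p.1‖) * h p.1) *
        (2 * π * p.2 i * (sin (2 * π * t * ‖p.2‖) * h p.2))) =
      (-(4 * π ^ 2) * (h p.1 * h p.2) * (cos (2 * π * t * ‖p.1‖) * cos (2 * π * t * ‖p.2‖) +
        sin (2 * π * t * ‖p.1‖) * sin (2 * π * t * ‖p.2‖))) * (p.1 i * p.2 i) := fun i => by ring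
  simp_rw [this]
  rw [← Finset.mul_sum]
  ring

end Wave

section Pairing

variable {n : ℕ}

/-- Pairing of `∑ c_k |A_k^∨|²` with the Newtonian potential of `μ`. -/
lemma integral_sum_normSq_synth_mul_newtonianPotential (hn : 3 ≤ n) {ι : Type*} [Fintype ι]
    {A : ι → E n → ℝ} (hA : ∀ k, Integrable (A k))
    (hA2 : ∀ k, Integrable fun x => ‖synth (A k) x‖ ^ 2) (c : ι → ℝ)
    {S₀ : E n × E n → ℝ} (hS₀ : Integrable S₀) (hS₀_nonneg : ∀ p, 0 ≤ S₀ p)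
    (hS : ∀ p : E n × E n, |∑ k, c k * (A k p.1 * A k p.2)| ≤ ‖p.1 - p.2‖ ^ 2 * S₀ p)
    (μ : Measure (E n)) [IsFiniteMeasure μ] :
    ∫ x, (∑ k, c k * ‖synth (A k) x‖ ^ 2) * newtonianPotential μ x =
      ∫ p : E n × E n, (∑ k, c k * (A k p.1 * A k p.2)) / (4 * π ^ 2 * ‖p.1 - p.2‖ ^ 2) *
        cosTransform μ (p.1 - p.2) := by
  have hφ : Integrable fun x => ∑ k, c k * ‖synth (A k) x‖ ^ 2 :=
    integrable_finsetSum _ fun k _ => (hA2 k).const_mul _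
  have hM : ∀ x, |∑ k, c k * ‖synth (A k) x‖ ^ 2| ≤ ∑ k, |c k| * (∫ ξ, |A k ξ|) ^ 2 := by
    intro x
    refine (Finset.abs_sum_le_sum_abs _ _).trans (Finset.sum_le_sum fun k _ => ?_)
    rw [abs_mul, abs_of_nonneg (sq_nonneg ‖synth (A k) x‖)]
    gcongr
    exact norm_synth_le x
  rw [integral_mul_newtonianPotential hn hφ hM]
  simp_rw [integral_sum_normSq_synth_mul_newtonKernel hn hA hA2 c hS₀ hS₀_nonneg hS]
  refine integral_integral_mul_cos_inner (B := fun p =>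
    (∑ k, c k * (A k p.1 * A k p.2)) / (4 * π ^ 2 * ‖p.1 - p.2‖ ^ 2)) ?_ μ
  refine hS₀.mono' ?_ (ae_of_all _ fun p => ?_)
  · refine AEStronglyMeasurable.div₀ ?_ ?_
    · refine Finset.aestronglyMeasurable_fun_sum _ fun k _ => AEStronglyMeasurable.const_mul ?_ _
      exact (hA k).aestronglyMeasurable.comp_fst.mul (hA k).aestronglyMeasurable.comp_snd
    · exact (by fun_prop : Continuous fun p : E n × E n =>
        4 * π ^ 2 * ‖p.1 - p.2‖ ^ 2).aestronglyMeasurable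
  · rw [norm_div, norm_eq_abs, norm_of_nonneg (by positivity)]
    refine div_le_of_le_mul₀ (by positivity) (hS₀_nonneg p) ((hS p).trans ?_)
    rw [mul_comm]
    refine mul_le_mul_of_nonneg_left ?_ (hS₀_nonneg p)
    have hπ : 1 ≤ 4 * π ^ 2 := by nlinarith [pi_gt_three]
    exact le_mul_of_one_le_left (sq_nonneg _) hπ

/-- The density on pairs of frequencies pairing `|g^∨|²` with `μ`. -/
def pairDensity (g : E n → ℝ) (μ : Measure (E n)) (p : E n × E n) : ℝ :=
  g p.1 * g p.2 * cosTransform μ (p.1 - p.2)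

/-- The difference of the time frequencies. -/
def freqGap (p : E n × E n) : ℝ := ‖p.1‖ - ‖p.2‖

lemma measurable_freqGap : Measurable (freqGap : E n × E n → ℝ) := by
  unfold freqGap
  fun_prop

lemma integrable_pairDensity {g : E n → ℝ} (hg : Integrable g) (μ : Measure (E n))
    [IsFiniteMeasure μ] : Integrable (pairDensity g μ) :=
  integrable_mul_cosTransform (hg.mul_prod hg) μ

lemma integrable_pairDensity_mul_nullKernel {g : E n → ℝ} (hg : Integrable g) (μ : Measure (E n))
    [IsFiniteMeasure μ] : Integrable fun p => pairDensity g μ p * nullKernel p :=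
  (integrable_pairDensity hg μ).mul_bdd (c := 1) measurable_nullKernel.aestronglyMeasurable
    (ae_of_all _ fun p => abs_nullKernel_le p)

lemma integral_nullForm_mul_newtonianPotential (hn : 3 ≤ n) {u₀ : E n → ℂ} {h : E n → ℝ}
    (hu : ∀ ξ, FT u₀ ξ = (h ξ : ℂ)) (hh : IsTestAmplitude h) (he : ∀ ξ, h (-ξ) = h ξ)
    (μ : Measure (E n)) [IsFiniteMeasure μ] (t : ℝ) :
    ∫ x, (‖dtWave u₀ t x‖ ^ 2 - ∑ i, ‖gradWaveComp u₀ t x i‖ ^ 2) * newtonianPotential μ x =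
      ∫ p, pairDensity h μ p * nullKernel p * cos (2 * π * t * freqGap p) := by
  simp_rw [nullForm_eq hu hh he]
  have hhi := hh.integrable
  have hS₀ : Integrable fun p : E n × E n => 2 * π ^ 2 * (|h p.1| * |h p.2|) :=
    (hhi.abs.mul_prod hhi.abs).const_mul _
  rw [integral_sum_normSq_synth_mul_newtonianPotential hn (fun k => (hh.waveAmp t k).integrable)
    (fun k => (hh.waveAmp t k).integrable_normSq_synth) (fun k => nullSign k.1) hS₀
    (fun p => by positivity) _ μ]
  · congr 1 with p
    rw [sum_waveAmp_mul, pairDensity, nullKernel, freqGap]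
    rcases eq_or_ne (‖p.1 - p.2‖ ^ 2) 0 with h0 | h0
    · simp [h0]
    · field_simp
  · intro p
    rw [sum_waveAmp_mul, abs_mul, abs_mul, abs_mul, abs_mul (h p.1),
      abs_of_nonneg (show 0 ≤ 4 * π ^ 2 by positivity)]
    calc _ ≤ 4 * π ^ 2 * (‖p.1 - p.2‖ ^ 2 / 2) * (|h p.1| * |h p.2|) * 1 := by
          gcongr
          · exact abs_nullSymbol_le _ _
          · exact abs_cos_le_one _
      _ = _ := by ring

lemma intervalIntegral_nullForm (hn : 3 ≤ n) {u₀ : E n → ℂ} {h : E n → ℝ}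
    (hu : ∀ ξ, FT u₀ ξ = (h ξ : ℂ)) (hh : IsTestAmplitude h) (he : ∀ ξ, h (-ξ) = h ξ)
    (μ : Measure (E n)) [IsFiniteMeasure μ] :
    ∫ t in (0 : ℝ)..1, ∫ x, (‖dtWave u₀ t x‖ ^ 2 - ∑ i, ‖gradWaveComp u₀ t x i‖ ^ 2) *
      newtonianPotential μ x =
      ∫ p, pairDensity h μ p * nullKernel p * sinc (2 * π * freqGap p) := by
  simp_rw [integral_nullForm_mul_newtonianPotential hn hu hh he]
  have := intervalIntegral_mul_integral_cos
    (integrable_pairDensity_mul_nullKernel hh.integrable μ) measurable_freqGap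
    (ω := fun _ => 1) continuous_const zero_le_one
  simp only [one_mul, integral_cos_eq_sinc] at this
  exact this

lemma integral_sum_normSq_synth_wavePhase {g : E n → ℝ} (hg : IsTestAmplitude g)
    (μ : Measure (E n)) [IsFiniteMeasure μ] (t : ℝ) :
    ∫ y, ∑ b, ‖synth (fun ξ => wavePhase t b ξ * g ξ) y‖ ^ 2 ∂μ =
      ∫ p, pairDensity g μ p * cos (2 * π * t * freqGap p) := by
  have hi := fun b => (hg.wavePhase_mul t b).integrable
  have hp : Integrable fun p : E n × E n =>
      g p.1 * g p.2 * cos (2 * π * t * freqGap p) :=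
    integrable_mul_cos (hg.integrable.mul_prod hg.integrable) measurable_freqGap t
  have h1 : ∀ y, ∑ b, ‖synth (fun ξ => wavePhase t b ξ * g ξ) y‖ ^ 2 =
      ∫ p : E n × E n, g p.1 * g p.2 * cos (2 * π * t * freqGap p) *
        cos (2 * π * ⟪y, p.1 - p.2⟫) := by
    intro y
    have hint : ∀ b, Integrable fun p : E n × E n => (wavePhase t b p.1 * g p.1) *
        (wavePhase t b p.2 * g p.2) * cos (2 * π * ⟪y, p.1 - p.2⟫) := fun b =>
      ((hi b).mul_prod (hi b)).mul_bdd (c := 1) (by fun_prop)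
        (ae_of_all _ fun p => by simpa using abs_cos_le_one _)
    simp_rw [normSq_synth (hi _)]
    rw [← integral_finsetSum _ fun b _ => hint b]
    congr 1 with p
    rw [Fintype.sum_bool, freqGap, mul_sub (2 * π * t), cos_sub]
    simp only [wavePhase]
    ring
  simp_rw [h1]
  rw [integral_integral_mul_cos_inner hp μ]
  congr 1 with p
  rw [pairDensity]
  ring

end Pairing

section Core

variable {n : ℕ}

/-- The symbol of `(|g^∨|² - |e^{2it√(-Δ)} g^∨|²)` paired with the Newtonian potential. -/
def gapKernel (p : E n × E n) : ℝ :=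
  (1 - cos (2 * π * 2 * freqGap p)) / (4 * π ^ 2 * ‖p.1 - p.2‖ ^ 2)

lemma one_sub_cos_freqGap_le (p : E n × E n) :
    |1 - cos (2 * π * 2 * freqGap p)| ≤ ‖p.1 - p.2‖ ^ 2 * (8 * π ^ 2) := by
  rw [abs_of_nonneg (sub_nonneg.mpr (cos_le_one _))]
  have h1 : freqGap p ^ 2 ≤ ‖p.1 - p.2‖ ^ 2 :=
    sq_le_sq' (abs_le.mp (abs_norm_sub_norm_le p.1 p.2)).1 (abs_le.mp (abs_norm_sub_norm_le p.1 p.2)).2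
  have h2 := one_sub_sq_div_two_le_cos (x := 2 * π * 2 * freqGap p)
  nlinarith [mul_le_mul_of_nonneg_left h1 (by positivity : 0 ≤ 8 * π ^ 2)]

lemma measurable_gapKernel : Measurable (gapKernel : E n × E n → ℝ) := by
  have := measurable_freqGap (n := n)
  unfold gapKernel
  fun_prop

lemma abs_gapKernel_le (p : E n × E n) : |gapKernel p| ≤ 2 := by
  rw [gapKernel, abs_div, abs_of_nonneg (show 0 ≤ 4 * π ^ 2 * ‖p.1 - p.2‖ ^ 2 by positivity)]
  refine div_le_of_le_mul₀ (by positivity) (by norm_num) ((one_sub_cos_freqGap_le p).trans_eq ?_)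
  ring

lemma sinc_sq_eq_nullKernel_add_gapKernel {p : E n × E n} (hp : p.1 ≠ p.2) :
    sinc (2 * π * freqGap p) ^ 2 =
      2 * (nullKernel p * sinc (2 * π * freqGap p) ^ 2) + gapKernel p / 2 := by
  have hw : ‖p.1 - p.2‖ ≠ 0 := norm_ne_zero_iff.mpr (sub_ne_zero.mpr hp)
  have h1 : 1 - cos (2 * π * 2 * freqGap p) =
      8 * π ^ 2 * (freqGap p ^ 2 * sinc (2 * π * freqGap p) ^ 2) := by
    have h2 : cos (2 * π * 2 * freqGap p) = 1 - 2 * sin (2 * π * freqGap p) ^ 2 := by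
      rw [show 2 * π * 2 * freqGap p = 2 * (2 * π * freqGap p) by ring, cos_two_mul, cos_sq']
      ring
    rw [h2]
    rcases eq_or_ne (freqGap p) 0 with h0 | h0
    · simp [h0]
    · rw [sinc_of_ne_zero (by positivity)]
      field_simp
      ring
  have h3 : ‖p.1‖ * ‖p.2‖ - ⟪p.1, p.2⟫ = (‖p.1 - p.2‖ ^ 2 - freqGap p ^ 2) / 2 := by
    rw [freqGap, ← two_mul_nullSymbol]
    ring
  rw [gapKernel, h1, nullKernel, h3]
  field_simp
  ring

lemma ae_fst_ne_snd (hn : 3 ≤ n) : ∀ᵐ p : E n × E n, p.1 ≠ p.2 := by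
  rw [Measure.volume_eq_prod, Measure.ae_prod_iff_ae_ae]
  · exact ae_of_all _ fun x => (ae_ne_point hn x).mono fun y hy => hy.symm
  · exact (measurableSet_eq_fun measurable_fst measurable_snd).compl

lemma integral_pairDensity_mul_gapKernel_le (hn : 3 ≤ n) {g : E n → ℝ} (hg : IsTestAmplitude g)
    (μ : Measure (E n)) [IsFiniteMeasure μ] :
    ∫ p, pairDensity g μ p * gapKernel p ≤ ∫ x, ‖synth g x‖ ^ 2 * newtonianPotential μ x := by
  let A : Option Bool → E n → ℝ := fun k => k.elim g fun b ξ => wavePhase 2 b ξ * g ξ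
  let c : Option Bool → ℝ := fun k => k.elim 1 fun _ => -1
  have hA : ∀ k, IsTestAmplitude (A k) := by
    rintro (_ | b)
    · exact hg
    · exact hg.wavePhase_mul 2 b
  have hsum : ∀ p : E n × E n, ∑ k, c k * (A k p.1 * A k p.2) =
      (1 - cos (2 * π * 2 * freqGap p)) * (g p.1 * g p.2) := by
    intro p
    rw [Fintype.sum_option, Fintype.sum_bool, freqGap, mul_sub (2 * π * 2), cos_sub]
    simp only [A, c, Option.elim, wavePhase]
    ring
  have hgi := hg.integrable
  have hS₀ : Integrable fun p : E n × E n => 8 * π ^ 2 * (|g p.1| * |g p.2|) :=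
    (hgi.abs.mul_prod hgi.abs).const_mul _
  have key := integral_sum_normSq_synth_mul_newtonianPotential hn
    (fun k => (hA k).integrable) (fun k => (hA k).integrable_normSq_synth) c hS₀
    (fun p => show 0 ≤ 8 * π ^ 2 * (|g p.1| * |g p.2|) by positivity) (fun p => by
      rw [hsum, abs_mul, abs_mul (g p.1)]
      exact (mul_le_mul_of_nonneg_right (one_sub_cos_freqGap_le p)
        (by positivity)).trans_eq (mul_assoc _ _ _)) μ
  have hb : ∀ x, ∑ k, c k * ‖synth (A k) x‖ ^ 2 ≤ ‖synth g x‖ ^ 2 := by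
    intro x
    rw [Fintype.sum_option]
    simp only [A, c, Option.elim, one_mul, neg_one_mul, Finset.sum_neg_distrib]
    have : 0 ≤ ∑ b, ‖synth (fun ξ => wavePhase 2 b ξ * g ξ) x‖ ^ 2 :=
      Finset.sum_nonneg fun b _ => sq_nonneg _
    linarith
  have hi : ∀ k, Integrable fun x => ‖synth (A k) x‖ ^ 2 * newtonianPotential μ x := fun k =>
    integrable_mul_newtonianPotential hn (hA k).integrable_normSq_synth
      (M := (∫ ξ, |A k ξ|) ^ 2) (fun x => by
        rw [abs_of_nonneg (sq_nonneg _)]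
        gcongr
        exact norm_synth_le x) μ
  calc ∫ p, pairDensity g μ p * gapKernel p
      = ∫ x, (∑ k, c k * ‖synth (A k) x‖ ^ 2) * newtonianPotential μ x := by
        rw [key]
        congr 1 with p
        rw [hsum, pairDensity, gapKernel]
        ring
    _ ≤ _ := by
        refine integral_mono ?_ (hi none)
          fun x => mul_le_mul_of_nonneg_right (hb x) (newtonianPotential_nonneg hn μ x)
        simp_rw [Finset.sum_mul, mul_assoc]
        exact integrable_finsetSum _ fun k _ => (hi k).const_mul _

lemma integral_pairDensity_mul_nullKernel_sinc_sq_le {g : E n → ℝ} (hg : IsTestAmplitude g)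
    (he : ∀ ξ, g (-ξ) = g ξ) (μ : Measure (E n)) [IsFiniteMeasure μ] {K s : ℝ}
    (hnull : ∀ h : E n → ℝ, IsTestAmplitude h → (∀ ξ, h (-ξ) = h ξ) →
      ∫ p, pairDensity h μ p * nullKernel p * sinc (2 * π * freqGap p) ≤
        K * ∫ ξ, (1 + ‖ξ‖ ^ 2) ^ s * h ξ ^ 2) :
    ∫ p, pairDensity g μ p * nullKernel p * sinc (2 * π * freqGap p) ^ 2 ≤
      K * ∫ ξ, (1 + ‖ξ‖ ^ 2) ^ s * g ξ ^ 2 := by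
  have hmf := measurable_freqGap (n := n)
  have hsm : Measurable fun p : E n × E n => sinc (2 * π * freqGap p) :=
    continuous_sinc.measurable.comp (hmf.const_mul _)
  have hint : ∀ h : E n → ℝ, IsTestAmplitude h → Integrable fun p =>
      pairDensity h μ p * nullKernel p * sinc (2 * π * freqGap p) := fun h hh =>
    (integrable_pairDensity_mul_nullKernel hh.integrable μ).mul_bdd (c := 1)
      hsm.aestronglyMeasurable (ae_of_all _ fun p => abs_sinc_le_one _)
  have hpt : ∀ r : ℝ, ∫ p, (pairDensity g μ p * nullKernel p * sinc (2 * π * freqGap p)) *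
      cos (2 * π * r * freqGap p) ≤ K * ∫ ξ, (1 + ‖ξ‖ ^ 2) ^ s * g ξ ^ 2 := by
    intro r
    have hb := fun b => hg.wavePhase_mul r b
    calc _ = ∫ p, ∑ b, pairDensity (fun ξ => wavePhase r b ξ * g ξ) μ p * nullKernel p *
            sinc (2 * π * freqGap p) := by
          congr 1 with p
          rw [Fintype.sum_bool, show cos (2 * π * r * freqGap p) =
            cos (2 * π * r * ‖p.1‖) * cos (2 * π * r * ‖p.2‖) +
              sin (2 * π * r * ‖p.1‖) * sin (2 * π * r * ‖p.2‖) by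
            rw [freqGap, mul_sub (2 * π * r), cos_sub]]
          simp only [pairDensity, wavePhase]
          ring
      _ = ∑ b, ∫ p, pairDensity (fun ξ => wavePhase r b ξ * g ξ) μ p * nullKernel p *
            sinc (2 * π * freqGap p) := integral_finsetSum _ fun b _ => hint _ (hb b)
      _ ≤ ∑ b, K * ∫ ξ, (1 + ‖ξ‖ ^ 2) ^ s * (wavePhase r b ξ * g ξ) ^ 2 :=
          Finset.sum_le_sum fun b _ => hnull _ (hb b) fun ξ => by rw [wavePhase_neg, he]
      _ = _ := by
          rw [← Finset.mul_sum, ← integral_finsetSum _ fun b _ => (hb b).integrable_weight s]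
          congr 2 with ξ
          rw [Fintype.sum_bool]
          simp only [wavePhase]
          linear_combination ((1 + ‖ξ‖ ^ 2) ^ s * g ξ ^ 2) * cos_sq_add_sin_sq (2 * π * r * ‖ξ‖)
  have key := intervalIntegral_mul_integral_cos (hint g hg) hmf (ω := fun _ => 1)
    continuous_const zero_le_one
  simp only [one_mul, integral_cos_eq_sinc] at key
  calc _ = ∫ p, pairDensity g μ p * nullKernel p * sinc (2 * π * freqGap p) *
        sinc (2 * π * freqGap p) := by
        congr 1 with p
        ring
    _ = ∫ r in (0 : ℝ)..1, ∫ p, pairDensity g μ p * nullKernel p * sinc (2 * π * freqGap p) *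
        cos (2 * π * r * freqGap p) := key.symm
    _ ≤ ∫ r in (0 : ℝ)..1, K * ∫ ξ, (1 + ‖ξ‖ ^ 2) ^ s * g ξ ^ 2 :=
        intervalIntegral.integral_mono_on zero_le_one
          ((continuous_integral_mul_cos (hint g hg) hmf).intervalIntegrable _ _)
          (continuous_const.intervalIntegrable _ _) fun r _ => hpt r
    _ = _ := by simp

lemma intervalIntegral_le_two_mul_fejer {m : ℝ → ℝ} (hm : Continuous m) (hm0 : ∀ t, 0 ≤ m t) :
    ∫ t in (0 : ℝ)..1, m t ≤ 2 * ∫ u in (0 : ℝ)..2, (1 - u / 2) * m u := by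
  have hc : Continuous fun u => (1 - u / 2) * m u := by fun_prop
  have h1 : ∫ t in (0 : ℝ)..1, (1 / 2) * m t ≤ ∫ u in (0 : ℝ)..1, (1 - u / 2) * m u :=
    intervalIntegral.integral_mono_on zero_le_one ((hm.const_mul _).intervalIntegrable _ _)
      (hc.intervalIntegrable _ _) fun t ht =>
        mul_le_mul_of_nonneg_right (by linarith [ht.2]) (hm0 t)
  have h2 : 0 ≤ ∫ u in (1 : ℝ)..2, (1 - u / 2) * m u :=
    intervalIntegral.integral_nonneg one_le_two fun u hu =>
      mul_nonneg (by linarith [hu.2]) (hm0 u)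
  rw [intervalIntegral.integral_const_mul] at h1
  rw [← intervalIntegral.integral_add_adjacent_intervals (hc.intervalIntegrable 0 1)
    (hc.intervalIntegrable 1 2)]
  linarith

lemma intervalIntegral_sum_normSq_wavePhase_le (hn : 3 ≤ n) {g : E n → ℝ} (hg : IsTestAmplitude g)
    (he : ∀ ξ, g (-ξ) = g ξ) (μ : Measure (E n)) [IsFiniteMeasure μ] {K s : ℝ}
    (hnull : ∀ h : E n → ℝ, IsTestAmplitude h → (∀ ξ, h (-ξ) = h ξ) →
      ∫ p, pairDensity h μ p * nullKernel p * sinc (2 * π * freqGap p) ≤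
        K * ∫ ξ, (1 + ‖ξ‖ ^ 2) ^ s * h ξ ^ 2) :
    ∫ t in (0 : ℝ)..1, ∫ y, ∑ b, ‖synth (fun ξ => wavePhase t b ξ * g ξ) y‖ ^ 2 ∂μ ≤
      4 * (K * ∫ ξ, (1 + ‖ξ‖ ^ 2) ^ s * g ξ ^ 2) +
        ∫ x, ‖synth g x‖ ^ 2 * newtonianPotential μ x := by
  have hmf := measurable_freqGap (n := n)
  have hq := integrable_pairDensity hg.integrable μ
  have hm0 : ∀ t, 0 ≤ ∫ p, pairDensity g μ p * cos (2 * π * t * freqGap p) := fun t => by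
    rw [← integral_sum_normSq_synth_wavePhase hg μ t]
    exact integral_nonneg fun y => Finset.sum_nonneg fun b _ => sq_nonneg _
  have hZ := intervalIntegral_mul_integral_cos hq hmf (ω := fun u => 1 - u / 2)
    (by fun_prop) zero_le_two
  simp only [integral_fejer_cos_eq_sinc_sq] at hZ
  have hR := integral_pairDensity_mul_nullKernel_sinc_sq_le hg he μ hnull
  have hE := integral_pairDensity_mul_gapKernel_le hn hg μ
  have hsm : Measurable fun p : E n × E n => sinc (2 * π * freqGap p) ^ 2 :=
    (continuous_sinc.measurable.comp (hmf.const_mul _)).pow_const 2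
  have hi1 : Integrable fun p =>
      pairDensity g μ p * nullKernel p * sinc (2 * π * freqGap p) ^ 2 :=
    (integrable_pairDensity_mul_nullKernel hg.integrable μ).mul_bdd (c := 1)
      hsm.aestronglyMeasurable (ae_of_all _ fun p => by
        rw [norm_pow]; exact pow_le_one₀ (norm_nonneg _) (abs_sinc_le_one _))
  have hi2 : Integrable fun p => pairDensity g μ p * gapKernel p :=
    hq.mul_bdd (c := 2) measurable_gapKernel.aestronglyMeasurable
      (ae_of_all _ fun p => abs_gapKernel_le p)
  have hsplit : ∫ p, pairDensity g μ p * sinc (2 * π * freqGap p) ^ 2 =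
      2 * (∫ p, pairDensity g μ p * nullKernel p * sinc (2 * π * freqGap p) ^ 2) +
        (1 / 2) * ∫ p, pairDensity g μ p * gapKernel p := by
    rw [← integral_const_mul, ← integral_const_mul,
      ← integral_add (hi1.const_mul _) (hi2.const_mul _)]
    refine integral_congr_ae ((ae_fst_ne_snd hn).mono fun p hp => ?_)
    simp only
    linear_combination pairDensity g μ p * sinc_sq_eq_nullKernel_add_gapKernel hp
  simp_rw [integral_sum_normSq_synth_wavePhase hg μ]
  have := intervalIntegral_le_two_mul_fejer (continuous_integral_mul_cos hq hmf) hm0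
  linarith

end Core

section Approximation

open scoped ContDiff FourierTransform SchwartzMap
open Filter Topology

variable {n : ℕ}

lemma sobolevNorm_sq (f : E n → ℂ) (s : ℝ) :
    sobolevNorm f s ^ 2 = ∫ ξ : E n, (1 + ‖ξ‖ ^ 2) ^ s * ‖FT f ξ‖ ^ 2 := by
  rw [sobolevNorm, ← sqrt_eq_rpow, sq_sqrt]
  exact integral_nonneg fun ξ => by positivity

lemma norm_exp_phase_mul (f : E n → ℂ) (t : ℝ) (x ξ : E n) :
    ‖Complex.exp (((2 * π * (⟪x, ξ⟫ + t * ‖ξ‖) : ℝ) : ℂ) * Complex.I) * f ξ‖ = ‖f ξ‖ := by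
  rw [norm_mul, Complex.norm_exp_ofReal_mul_I, one_mul]

lemma integrable_exp_phase_mul {f : E n → ℂ} (hf : Integrable f) (t : ℝ) (x : E n) :
    Integrable fun ξ =>
      Complex.exp (((2 * π * (⟪x, ξ⟫ + t * ‖ξ‖) : ℝ) : ℂ) * Complex.I) * f ξ :=
  hf.bdd_mul (c := 1) (by fun_prop)
    (ae_of_all _ fun ξ => (Complex.norm_exp_ofReal_mul_I _).le)

lemma norm_halfWave_le (f : E n → ℂ) (t : ℝ) (x : E n) : ‖halfWave f t x‖ ≤ ∫ ξ, ‖FT f ξ‖ := by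
  refine (norm_integral_le_integral_norm _).trans_eq ?_
  simp_rw [norm_exp_phase_mul]

lemma norm_halfWave_sub_le {f h : E n → ℂ} (hf : Integrable (FT f)) (hh : Integrable (FT h))
    (t : ℝ) (x : E n) :
    ‖halfWave f t x - halfWave h t x‖ ≤ ∫ ξ, ‖FT f ξ - FT h ξ‖ := by
  rw [halfWave, halfWave, ← integral_sub (integrable_exp_phase_mul hf t x)
    (integrable_exp_phase_mul hh t x)]
  refine (norm_integral_le_integral_norm _).trans_eq ?_
  simp_rw [← mul_sub]
  congr 1 with ξ
  exact norm_exp_phase_mul (fun ξ => FT f ξ - FT h ξ) t x ξ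

lemma continuous_halfWave {f : E n → ℂ} (hf : Integrable (FT f)) :
    Continuous fun p : ℝ × E n => halfWave f p.1 p.2 :=
  continuous_of_dominated (bound := fun ξ => ‖FT f ξ‖)
    (fun p => (integrable_exp_phase_mul hf p.1 p.2).aestronglyMeasurable)
    (fun p => ae_of_all _ fun ξ => (norm_exp_phase_mul _ p.1 p.2 ξ).le) hf.norm
    (ae_of_all _ fun ξ => by fun_prop)

lemma normSq_halfWave_le (f : E n → ℂ) (t : ℝ) (x : E n) :
    ‖‖halfWave f t x‖ ^ 2‖ ≤ (∫ ξ, ‖FT f ξ‖) ^ 2 := by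
  rw [norm_pow, norm_norm]
  gcongr
  exact norm_halfWave_le f t x

lemma aestronglyMeasurable_normSq_halfWave {f : E n → ℂ} (hf : Integrable (FT f))
    (μ : Measure (E n)) (t : ℝ) : AEStronglyMeasurable (fun x => ‖halfWave f t x‖ ^ 2) μ :=
  (((continuous_halfWave hf).comp (Continuous.prodMk_right t)).norm.pow 2).aestronglyMeasurable

lemma integrable_normSq_halfWave {f : E n → ℂ} (hf : Integrable (FT f))
    (μ : Measure (E n)) [IsFiniteMeasure μ] (t : ℝ) :
    Integrable (fun x => ‖halfWave f t x‖ ^ 2) μ :=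
  (integrable_const ((∫ ξ, ‖FT f ξ‖) ^ 2)).mono' (aestronglyMeasurable_normSq_halfWave hf μ t)
    (ae_of_all _ fun x => normSq_halfWave_le f t x)

lemma continuous_integral_normSq_halfWave {f : E n → ℂ} (hf : Integrable (FT f))
    (μ : Measure (E n)) [IsFiniteMeasure μ] :
    Continuous fun t => ∫ x, ‖halfWave f t x‖ ^ 2 ∂μ :=
  continuous_of_dominated (bound := fun _ => (∫ ξ, ‖FT f ξ‖) ^ 2)
    (fun t => aestronglyMeasurable_normSq_halfWave hf μ t)
    (fun t => ae_of_all _ fun x => normSq_halfWave_le f t x) (integrable_const _)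
    (ae_of_all _ fun x => ((continuous_halfWave hf).comp (Continuous.prodMk_left x)).norm.pow 2)

/-- `L¹` stability of the space-time integral under perturbing the Fourier transform. -/
lemma intervalIntegral_normSq_halfWave_le {f h : E n → ℂ} (hf : Integrable (FT f))
    (hh : Integrable (FT h)) (μ : Measure (E n)) [IsFiniteMeasure μ] :
    ∫ t in (0 : ℝ)..1, ∫ x, ‖halfWave f t x‖ ^ 2 ∂μ ≤
      2 * (∫ t in (0 : ℝ)..1, ∫ x, ‖halfWave h t x‖ ^ 2 ∂μ) +
        2 * (∫ ξ, ‖FT f ξ - FT h ξ‖) ^ 2 * μ.real Set.univ := by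
  set D := ∫ ξ, ‖FT f ξ - FT h ξ‖
  have hpt : ∀ t x, ‖halfWave f t x‖ ^ 2 ≤ 2 * ‖halfWave h t x‖ ^ 2 + 2 * D ^ 2 := by
    intro t x
    have h1 := norm_halfWave_sub_le hf hh t x
    have h2 := norm_le_norm_add_norm_sub' (halfWave f t x) (halfWave h t x)
    have h3 := norm_nonneg (halfWave f t x)
    nlinarith [sq_nonneg (‖halfWave h t x‖ - D)]
  have hin : ∀ t, ∫ x, ‖halfWave f t x‖ ^ 2 ∂μ ≤
      2 * (∫ x, ‖halfWave h t x‖ ^ 2 ∂μ) + 2 * D ^ 2 * μ.real Set.univ := by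
    intro t
    have hi := (integrable_normSq_halfWave hh μ t).const_mul 2
    calc _ ≤ ∫ x, (2 * ‖halfWave h t x‖ ^ 2 + 2 * D ^ 2) ∂μ :=
          integral_mono (integrable_normSq_halfWave hf μ t) (hi.add (integrable_const _)) (hpt t)
      _ = _ := by
          rw [integral_add hi (integrable_const _), integral_const_mul, integral_const,
            smul_eq_mul, mul_comm (μ.real _)]
  have hc := (continuous_integral_normSq_halfWave hh μ).const_mul 2
  calc _ ≤ ∫ t in (0 : ℝ)..1, (2 * (∫ x, ‖halfWave h t x‖ ^ 2 ∂μ) +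
        2 * D ^ 2 * μ.real Set.univ) :=
        intervalIntegral.integral_mono_on zero_le_one
          ((continuous_integral_normSq_halfWave hf μ).intervalIntegrable _ _)
          ((hc.add continuous_const).intervalIntegrable _ _) fun t _ => hin t
    _ = _ := by
        rw [intervalIntegral.integral_add (hc.intervalIntegrable _ _)
          (continuous_const.intervalIntegrable _ _), intervalIntegral.integral_const_mul]
        simp

lemma integrable_FT (u₀ : 𝓢(E n, ℂ)) : Integrable (FT u₀) := by
  rw [funext (FT_eq_fourier u₀)]
  exact SchwartzMap.integrable _

lemma contDiff_re_FT (u₀ : 𝓢(E n, ℂ)) : ContDiff ℝ ∞ fun ξ => (FT u₀ ξ).re := by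
  simp only [FT_eq_fourier]
  exact Complex.reCLM.contDiff.comp (SchwartzMap.smooth _ _)

lemma integrable_weight_normSq_FT (u₀ : 𝓢(E n, ℂ)) (s : ℝ) :
    Integrable fun ξ => (1 + ‖ξ‖ ^ 2) ^ s * ‖FT u₀ ξ‖ ^ 2 := by
  simp_rw [FT_eq_fourier]
  set S : 𝓢(E n, ℂ) := 𝓕 u₀
  obtain ⟨N, hN⟩ := exists_nat_ge s
  obtain ⟨M, hM⟩ := S.decay 0 0
  simp only [pow_zero, one_mul, norm_iteratedFDeriv_zero] at hM
  have hM0 : 0 ≤ M := (norm_nonneg _).trans (hM.2 0)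
  have hi : Integrable fun ξ => 2 ^ (N - 1) * M * (‖S ξ‖ + ‖ξ‖ ^ (2 * N) * ‖S ξ‖) :=
    (S.integrable.norm.add (S.integrable_pow_mul volume (2 * N))).const_mul _
  refine hi.mono' ?_ (ae_of_all _ fun ξ => ?_)
  · refine Continuous.aestronglyMeasurable (Continuous.mul ?_ (S.continuous.norm.pow 2))
    exact Continuous.rpow_const (by fun_prop) fun ξ => Or.inl (by positivity)
  · rw [norm_of_nonneg (by positivity)]
    have h1 : (1 + ‖ξ‖ ^ 2) ^ s ≤ 2 ^ (N - 1) * (1 + ‖ξ‖ ^ (2 * N)) := by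
      calc (1 + ‖ξ‖ ^ 2) ^ s ≤ (1 + ‖ξ‖ ^ 2) ^ (N : ℝ) :=
            rpow_le_rpow_of_exponent_le (by nlinarith [sq_nonneg ‖ξ‖]) hN
        _ = (1 + ‖ξ‖ ^ 2) ^ N := rpow_natCast _ _
        _ ≤ 2 ^ (N - 1) * (1 ^ N + (‖ξ‖ ^ 2) ^ N) := add_pow_le zero_le_one (sq_nonneg _) N
        _ = _ := by rw [one_pow, ← pow_mul]
    calc (1 + ‖ξ‖ ^ 2) ^ s * ‖S ξ‖ ^ 2 ≤
          2 ^ (N - 1) * (1 + ‖ξ‖ ^ (2 * N)) * (M * ‖S ξ‖) := by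
          rw [sq ‖S ξ‖]
          gcongr
          exact hM.2 ξ
      _ = _ := by ring

/-- A smooth cutoff to frequencies `1 / k ≤ |ξ|² ≤ k`. -/
def freqCutoff (k : ℕ) (ξ : E n) : ℝ :=
  smoothTransition (k * ‖ξ‖ ^ 2 - 1) * smoothTransition (k - ‖ξ‖ ^ 2)

lemma freqCutoff_nonneg (k : ℕ) (ξ : E n) : 0 ≤ freqCutoff k ξ :=
  mul_nonneg (smoothTransition.nonneg _) (smoothTransition.nonneg _)

lemma freqCutoff_le_one (k : ℕ) (ξ : E n) : freqCutoff k ξ ≤ 1 :=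
  mul_le_one₀ (smoothTransition.le_one _) (smoothTransition.nonneg _) (smoothTransition.le_one _)

lemma contDiff_freqCutoff (k : ℕ) : ContDiff ℝ ∞ (freqCutoff k : E n → ℝ) := by
  have h := contDiff_norm_sq ℝ (E := E n) (n := ∞)
  exact (smoothTransition.contDiff.comp ((contDiff_const.mul h).sub contDiff_const)).mul
    (smoothTransition.contDiff.comp (contDiff_const.sub h))

lemma isTestAmplitude_freqCutoff_mul (k : ℕ) {g : E n → ℝ} (hg : ContDiff ℝ ∞ g) :
    IsTestAmplitude fun ξ => freqCutoff k ξ * g ξ where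
  contDiff := (contDiff_freqCutoff k).mul hg
  hasCompactSupport := by
    refine HasCompactSupport.mul_right ?_
    refine HasCompactSupport.intro (isCompact_closedBall 0 (k : ℝ)) fun ξ hξ => ?_
    rw [mem_closedBall_zero_iff, not_le] at hξ
    rw [freqCutoff, smoothTransition.zero_of_nonpos (x := k - ‖ξ‖ ^ 2), mul_zero]
    rcases Nat.eq_zero_or_pos k with rfl | hk
    · simp
    · have : (1 : ℝ) ≤ k := by exact_mod_cast hk
      nlinarith
  eventually_eq_zero := by
    have hc : Continuous fun ξ : E n => (k : ℝ) * ‖ξ‖ ^ 2 - 1 := by fun_prop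
    have h0 := hc.continuousAt.eventually_lt (x₀ := 0) (g := fun _ => (0 : ℝ))
      continuousAt_const (by simp)
    filter_upwards [h0] with ξ hξ
    rw [freqCutoff, smoothTransition.zero_of_nonpos hξ.le, zero_mul, zero_mul]

lemma tendsto_freqCutoff {ξ : E n} (hξ : ξ ≠ 0) :
    Tendsto (fun k => freqCutoff k ξ) atTop (𝓝 1) := by
  have hpos : 0 < ‖ξ‖ ^ 2 := by positivity
  refine tendsto_const_nhds.congr' ?_
  filter_upwards [tendsto_natCast_atTop_atTop.eventually_ge_atTop (2 / ‖ξ‖ ^ 2),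
    tendsto_natCast_atTop_atTop.eventually_ge_atTop (1 + ‖ξ‖ ^ 2)] with k h1 h2
  rw [div_le_iff₀ hpos] at h1
  rw [freqCutoff, smoothTransition.one_of_one_le (by linarith),
    smoothTransition.one_of_one_le (by linarith), mul_one]

lemma tendsto_integral_sub_freqCutoff (hn : 3 ≤ n) {g : E n → ℝ} (hg : Integrable g) :
    Tendsto (fun k : ℕ => ∫ ξ, |g ξ - freqCutoff k ξ * g ξ|) atTop (𝓝 0) := by
  rw [← integral_zero (E n) ℝ]
  refine tendsto_integral_of_dominated_convergence (fun ξ => |g ξ|) (fun k => ?_) hg.abs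
    (fun k => ae_of_all _ fun ξ => ?_) ?_
  · exact (hg.aestronglyMeasurable.sub ((contDiff_freqCutoff k).continuous.aestronglyMeasurable.mul
      hg.aestronglyMeasurable)).norm
  · rw [norm_abs_eq_norm, norm_eq_abs, show g ξ - freqCutoff k ξ * g ξ =
      (1 - freqCutoff k ξ) * g ξ by ring, abs_mul,
      abs_of_nonneg (sub_nonneg.mpr (freqCutoff_le_one k ξ))]
    exact mul_le_of_le_one_left (abs_nonneg _) (by linarith [freqCutoff_nonneg k ξ])
  · filter_upwards [ae_ne_point hn 0] with ξ hξ
    simpa using (((tendsto_freqCutoff hξ).mul_const (g ξ)).const_sub (g ξ)).abs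

end Approximation

/-- The Strichartz bound for data whose Fourier transform is a test amplitude. -/
lemma intervalIntegral_sum_normSq_wavePhase_le_weight {n : ℕ} (hn : 3 ≤ n) {C K F q s σ : ℝ}
    (hC : 0 ≤ C) (hK : 0 ≤ K) (hF : 0 ≤ F) (hq : 1 < q) (hσ : q - 1 < σ) (hs : s ≤ σ)
    (μ : Measure (E n)) [IsFiniteMeasure μ]
    (hμ : ∀ τ > 0, ∀ x, ∫ z, heat τ (x - z) ∂μ ≤ K * F * τ ^ (-q))
    (hnull : ∀ h : E n → ℝ, IsTestAmplitude h → (∀ ξ, h (-ξ) = h ξ) →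
      ∫ p, pairDensity h μ p * nullKernel p * sinc (2 * π * freqGap p) ≤
        C * F * ∫ ξ, (1 + ‖ξ‖ ^ 2) ^ s * h ξ ^ 2)
    {g : E n → ℝ} (hg : IsTestAmplitude g) (he : ∀ ξ, g (-ξ) = g ξ) :
    ∫ t in (0 : ℝ)..1, ∫ y, ∑ b, ‖synth (fun ξ => wavePhase t b ξ * g ξ) y‖ ^ 2 ∂μ ≤
      (4 * C + traceConst q σ * K) * F * ∫ ξ, (1 + ‖ξ‖ ^ 2) ^ σ * g ξ ^ 2 := by
  have h1 := intervalIntegral_sum_normSq_wavePhase_le hn hg he μ hnull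
  have h2 := integral_normSq_synth_mul_newtonianPotential_le hn μ hq hσ (mul_nonneg hK hF) hμ
    hg.integrable hg.integrable_synth (synth_im_of_even he) (hg.integrable_weight σ)
  have h3 : ∫ ξ, (1 + ‖ξ‖ ^ 2) ^ s * g ξ ^ 2 ≤ ∫ ξ, (1 + ‖ξ‖ ^ 2) ^ σ * g ξ ^ 2 := by
    refine integral_mono (hg.integrable_weight s) (hg.integrable_weight σ) fun ξ => ?_
    have : 1 ≤ 1 + ‖ξ‖ ^ 2 := by nlinarith [sq_nonneg ‖ξ‖]
    dsimp only
    gcongr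
  have h4 := mul_le_mul_of_nonneg_left h3 (mul_nonneg hC hF)
  linarith

/-- null-form estimates with weight `(-Δ)⁻¹μ` imply Strichartz estimates with
respect to the fractal measure `μ`, up to half a derivative. -/
theorem strichartz_from_nullform (n : ℕ) (hn : 3 ≤ n) (α γstar C : ℝ)
    (hα₀ : 0 < α) (hα₁ : α ≤ (n : ℝ) - 2) (hγstar : 0 < γstar) (hC : 0 < C)
    (H : ∀ (u₀ : SchwartzMap (E n) ℂ), (∀ x, (u₀ x).im = 0) → (∀ x, u₀ (-x) = u₀ x) →
      ∀ (μ : Measure (E n)), IsFiniteMeasure μ →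
        μ.map (fun x => -x) = μ →
        μ (Metric.ball (0 : E n) 4)ᶜ = 0 → frostman μ α < ⊤ →
        (∫ t in (0:ℝ)..1, ∫ x : E n,
            (‖dtWave (⇑u₀) t x‖ ^ 2 - ∑ i : Fin n, ‖gradWaveComp (⇑u₀) t x i‖ ^ 2) *
              newtonianPotential μ x) ≤
          C * (frostman μ α).toReal * sobolevNorm (⇑u₀) (((n : ℝ) - α) / 2 - γstar) ^ 2) :
    ∀ γ : ℝ, γ < min γstar (1/2) → ∃ C' : ℝ, 0 < C' ∧
      ∀ (u₀ : SchwartzMap (E n) ℂ), (∀ x, (u₀ x).im = 0) → (∀ x, u₀ (-x) = u₀ x) →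
        ∀ (μ : Measure (E n)), IsFiniteMeasure μ →
          μ.map (fun x => -x) = μ →
          μ (Metric.ball (0 : E n) 4)ᶜ = 0 → frostman μ α < ⊤ →
          (∫ t in (0:ℝ)..1, ∫ x, ‖halfWave (⇑u₀) t x‖ ^ 2 ∂μ) ≤
            C' * (frostman μ α).toReal * sobolevNorm (⇑u₀) (((n : ℝ) - α) / 2 - γ) ^ 2 := by
  intro γ hγ
  obtain ⟨hγ₁, hγ₂⟩ := lt_min_iff.mp hγ
  obtain ⟨ε, hε, hεα, hε4⟩ : ∃ ε : ℝ, 0 < ε ∧ ε ≤ α / 4 ∧ ε ≤ 1 / 4 :=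
    ⟨min (α / 4) (1 / 4), by positivity, min_le_left _ _, min_le_right _ _⟩
  obtain ⟨C₀, hC₀, hheat⟩ := exists_integral_heat_le_frostman n (α := α) (β := α - 2 * ε) (R := 4)
    (by linarith) (by linarith) (by norm_num)
  set q : ℝ := ((n : ℝ) - (α - 2 * ε)) / 2 with hq_def
  set s : ℝ := ((n : ℝ) - α) / 2 - γstar with hs_def
  set σ : ℝ := ((n : ℝ) - α) / 2 - γ with hσ_def
  have hq : 1 < q := by linarith
  have hσ : q - 1 < σ := by linarith
  have hT := traceConst_pos hq hσ
  refine ⟨2 * (4 * C + traceConst q σ * C₀), by positivity, ?_⟩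
  intro u₀ hre heven μ hμfin hμeven hμsupp hμF
  set F := (frostman μ α).toReal
  have hF : 0 ≤ F := ENNReal.toReal_nonneg
  have hnull : ∀ h : E n → ℝ, IsTestAmplitude h → (∀ ξ, h (-ξ) = h ξ) →
      ∫ p, pairDensity h μ p * nullKernel p * sinc (2 * π * freqGap p) ≤
        C * F * ∫ ξ, (1 + ‖ξ‖ ^ 2) ^ s * h ξ ^ 2 := by
    intro h hh he
    obtain ⟨v, hv_re, hv_even, hv⟩ := hh.exists_schwartz he
    have := H v hv_re hv_even μ hμfin hμeven hμsupp hμF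
    rw [intervalIntegral_nullForm hn hv hh he, sobolevNorm_sq] at this
    simpa only [hv, Complex.norm_real, norm_eq_abs, sq_abs] using this
  set g : E n → ℝ := fun ξ => (FT u₀ ξ).re with hg_def
  have hg : ∀ ξ, FT u₀ ξ = (g ξ : ℂ) := fun ξ =>
    Complex.ext rfl (FT_im_of_even hre heven ξ)
  have hg_even : ∀ ξ, g (-ξ) = g ξ := fun ξ => by rw [hg_def]; simp only [FT_neg_of_even heven]
  have hu_int := integrable_FT u₀
  have hg_int : Integrable g := hu_int.re
  have hweight := integrable_weight_normSq_FT u₀ σ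
  have hbound : ∀ k : ℕ, ∫ t in (0 : ℝ)..1, ∫ x, ‖halfWave u₀ t x‖ ^ 2 ∂μ ≤
      2 * ((4 * C + traceConst q σ * C₀) * F * sobolevNorm u₀ σ ^ 2) +
        2 * (∫ ξ, |g ξ - freqCutoff k ξ * g ξ|) ^ 2 * μ.real Set.univ := by
    intro k
    have hk : IsTestAmplitude fun ξ => freqCutoff k ξ * g ξ :=
      isTestAmplitude_freqCutoff_mul k (contDiff_re_FT u₀)
    have hk_even : ∀ ξ, freqCutoff k (-ξ) * g (-ξ) = freqCutoff k ξ * g ξ := fun ξ => by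
      rw [hg_even, freqCutoff, norm_neg, freqCutoff]
    obtain ⟨v, -, -, hv⟩ := hk.exists_schwartz hk_even
    have h1 := intervalIntegral_normSq_halfWave_le hu_int (integrable_FT v) μ
    simp only [normSq_halfWave hv hk hk_even, hg, hv, ← Complex.ofReal_sub, Complex.norm_real,
      norm_eq_abs] at h1
    have h2 := intervalIntegral_sum_normSq_wavePhase_le_weight hn hC.le hC₀.le hF hq hσ
      (by linarith : s ≤ σ) μ (hheat μ hμF hμsupp) hnull hk hk_even
    have h3 : ∫ ξ, (1 + ‖ξ‖ ^ 2) ^ σ * (freqCutoff k ξ * g ξ) ^ 2 ≤ sobolevNorm u₀ σ ^ 2 := by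
      rw [sobolevNorm_sq]
      refine integral_mono (hk.integrable_weight σ) hweight fun ξ => ?_
      simp only [hg, Complex.norm_real, norm_eq_abs, sq_abs, mul_pow]
      have : freqCutoff k ξ ^ 2 ≤ 1 := pow_le_one₀ (freqCutoff_nonneg k ξ) (freqCutoff_le_one k ξ)
      gcongr
      exact mul_le_of_le_one_left (sq_nonneg _) this
    have h4 := h2.trans (mul_le_mul_of_nonneg_left h3 (by positivity))
    linarith
  have hlim := ((((tendsto_integral_sub_freqCutoff hn hg_int).pow 2).const_mul 2).mul_const
    (μ.real Set.univ)).const_add (2 * ((4 * C + traceConst q σ * C₀) * F * sobolevNorm u₀ σ ^ 2))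
  refine (ge_of_tendsto' hlim hbound).trans_eq ?_
  ring
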